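/- arXiv:1805.10885 — 7 statements merged into one kernel-verified Lean document; each statement's English description precedes it below -/
import Mathlib

section
/- Fix a real number p with 1 ≤ p < 2. There exist constants κ > 0, C₀ > 0 and δ₀ ∈ (0,1), depending only on p, such that the following holds. Let 0 < ε < 1/2, let 0 < δ < δ₀, and let n be an integer with n ≥ C₀ ε^{−2} log(1/δ). If (ρ, f) is an (ε,δ)-sketching scheme for F_p on ℝⁿ with sketching dimension r, then r ≥ κ ε^{−2} log(1/δ). -/
open MeasureTheory

/-- `F_p(x) = ∑ i |x_i|^p`. -/
noncomputable def Fp (p : ℝ) {n : ℕ} (x : Fin n → ℝ) : ℝ := ∑ i, |x i| ^ p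

/-- `(ρ, f)` is an `(ε,δ)`-sketching scheme for `F_p` on `ℝⁿ` with sketching dimension `r`:
`ρ` is a Borel probability measure on real `r × n` matrices (modeled as `Fin r → Fin n → ℝ`),
`f` is measurable, and for every `x`, with `ρ`-probability at least `1 - δ` over `S` one has
`|f(S, S·x) − ‖x‖_p^p| ≤ ε·‖x‖_p^p`. -/
def IsSketchingScheme (p : ℝ) (n r : ℕ) (ε δ : ℝ)
    (ρ : Measure (Fin r → Fin n → ℝ))
    (f : (Fin r → Fin n → ℝ) → (Fin r → ℝ) → ℝ) : Prop :=
  IsProbabilityMeasure ρ ∧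
  Measurable (fun q : (Fin r → Fin n → ℝ) × (Fin r → ℝ) => f q.1 q.2) ∧
  ∀ x : Fin n → ℝ,
    ENNReal.ofReal (1 - δ) ≤
      ρ {S | |f S (fun k => ∑ i, S k i * x i) - Fp p x| ≤ ε * Fp p x}

open ProbabilityTheory
open scoped ENNReal NNReal

theorem pi_withDensity_ofReal {ι : Type*} [Fintype ι] (μ : ι → Measure ℝ)
    [∀ i, IsProbabilityMeasure (μ i)] (L : ι → ℝ → ℝ) (hL0 : ∀ i x, 0 ≤ L i x)
    (hLi : ∀ i, Integrable (L i) (μ i)) :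
    Measure.pi (fun i => (μ i).withDensity fun x => ENNReal.ofReal (L i x)) =
      (Measure.pi μ).withDensity fun x => ENNReal.ofReal (∏ i, L i (x i)) := by
  have hfin (i : ι) : IsFiniteMeasure ((μ i).withDensity fun x => ENNReal.ofReal (L i x)) :=
    isFiniteMeasure_withDensity_ofReal (hLi i).2
  refine Measure.pi_eq fun s hs => ?_
  rw [withDensity_apply _ (MeasurableSet.univ_pi hs), Measure.restrict_pi_pi,
    ← ofReal_integral_eq_lintegral_ofReal
      (Integrable.fintype_prod fun i => (hLi i).mono_measure Measure.restrict_le_self)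
      (ae_of_all _ fun x => Finset.prod_nonneg fun i _ => hL0 i _),
    integral_fintype_prod_eq_prod, ENNReal.ofReal_prod_of_nonneg
      fun i _ => integral_nonneg fun x => hL0 i x]
  refine Finset.prod_congr rfl fun i _ => ?_
  rw [withDensity_apply _ (hs i), ofReal_integral_eq_lintegral_ofReal
    ((hLi i).mono_measure Measure.restrict_le_self) (ae_of_all _ fun x => hL0 i x)]

theorem sq_setIntegral_le {Ω : Type*} [MeasurableSpace Ω] (μ : Measure Ω) [IsFiniteMeasure μ]
    {L : Ω → ℝ} (hLi : Integrable L μ)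
    (hL2 : Integrable (fun x => L x ^ 2) μ) (B : Set Ω) :
    (∫ x in B, L x ∂μ) ^ 2 ≤ μ.real B * ∫ x, L x ^ 2 ∂μ := by
  set a := ∫ x in B, L x ∂μ
  set m := μ.real B
  set M := ∫ x, L x ^ 2 ∂μ
  have hm : 0 ≤ m := measureReal_nonneg
  have hM : ∫ x in B, L x ^ 2 ∂μ ≤ M :=
    setIntegral_le_integral hL2 (ae_of_all _ fun x => sq_nonneg _)
  have h (t : ℝ) : 0 ≤ t ^ 2 * m - 2 * t * a + M := by
    have h1 : 0 ≤ ∫ x in B, (t - L x) ^ 2 ∂μ := integral_nonneg fun x => sq_nonneg _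
    have h2 : ∫ x in B, (t - L x) ^ 2 ∂μ = t ^ 2 * m - 2 * t * a + ∫ x in B, L x ^ 2 ∂μ := by
      have : ∀ x, (t - L x) ^ 2 = t ^ 2 - 2 * t * L x + L x ^ 2 := fun x => by ring
      simp_rw [this]
      rw [integral_add, integral_sub, integral_const_mul]
      · simp [m, a, mul_comm]
      · simp
      · exact (hLi.integrableOn).const_mul _
      · exact (integrable_const _).sub (hLi.integrableOn.const_mul _)
      · exact hL2.integrableOn
    linarith
  have hd := discrim_le_zero (a := m) (b := -2 * a) (c := M) fun t => by
    have := h t; nlinarith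
  unfold discrim at hd
  nlinarith

theorem sq_pi_withDensity_le {ι : Type*} [Fintype ι] (μ : ι → Measure ℝ)
    [∀ i, IsProbabilityMeasure (μ i)] (L : ι → ℝ → ℝ) (hL0 : ∀ i x, 0 ≤ L i x)
    (hLi : ∀ i, Integrable (L i) (μ i)) (hL2 : ∀ i, Integrable (fun x => L i x ^ 2) (μ i))
    {B : Set (ι → ℝ)} (hB : MeasurableSet B) :
    ((Measure.pi fun i => (μ i).withDensity fun x => ENNReal.ofReal (L i x)).real B) ^ 2 ≤
      (Measure.pi μ).real B * ∏ i, ∫ x, L i x ^ 2 ∂μ i := by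
  have hi : Integrable (fun x : ι → ℝ => ∏ i, L i (x i)) (Measure.pi μ) :=
    Integrable.fintype_prod hLi
  have hi2 : Integrable (fun x : ι → ℝ => (∏ i, L i (x i)) ^ 2) (Measure.pi μ) := by
    simp_rw [← Finset.prod_pow]
    exact Integrable.fintype_prod (f := fun i x => L i x ^ 2) hL2
  have h := sq_setIntegral_le (Measure.pi μ) hi hi2 B
  have e : ∫ x, (∏ i, L i (x i)) ^ 2 ∂Measure.pi μ = ∏ i, ∫ x, L i x ^ 2 ∂μ i := by
    simp_rw [← Finset.prod_pow]
    exact integral_fintype_prod_eq_prod (fun i x => L i x ^ 2)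
  rw [e] at h
  convert h using 2
  have h0 (x : ι → ℝ) : 0 ≤ ∏ i, L i (x i) := Finset.prod_nonneg fun i _ => hL0 i _
  rw [pi_withDensity_ofReal μ L hL0 hLi, measureReal_def, withDensity_apply _ hB,
    ← ofReal_integral_eq_lintegral_ofReal hi.integrableOn (ae_of_all _ h0),
    ENNReal.toReal_ofReal (integral_nonneg h0)]

theorem gaussianReal_one_eq_withDensity {s : ℝ≥0} (hs : s ≠ 0) :
    gaussianReal 0 1 = (gaussianReal 0 s).withDensity fun x =>
      ENNReal.ofReal (gaussianPDFReal 0 1 x / gaussianPDFReal 0 s x) := by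
  rw [gaussianReal_of_var_ne_zero _ one_ne_zero, gaussianReal_of_var_ne_zero _ hs,
    ← withDensity_mul _ (measurable_gaussianPDF 0 s) (by fun_prop)]
  congr 1
  ext1 x
  have := gaussianPDFReal_pos 0 s x hs
  simp only [Pi.mul_apply, gaussianPDF]
  rw [← ENNReal.ofReal_mul this.le]
  congr 1
  field_simp

theorem gaussianPDFReal_sq_div {s : ℝ≥0} (hs : 1 < s) (x : ℝ) :
    gaussianPDFReal 0 s x * (gaussianPDFReal 0 1 x / gaussianPDFReal 0 s x) ^ 2 =
      √(s : ℝ) / √(2 * Real.pi) * Real.exp (-(1 - 1 / (2 * s)) * x ^ 2) := by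
  have hs0 : (0 : ℝ) < s := by exact_mod_cast zero_lt_one.trans hs
  have hp := gaussianPDFReal_pos 0 s x (by positivity)
  have e : gaussianPDFReal 0 s x * (gaussianPDFReal 0 1 x / gaussianPDFReal 0 s x) ^ 2 =
      gaussianPDFReal 0 1 x ^ 2 / gaussianPDFReal 0 s x := by field_simp
  rw [e, div_eq_iff hp.ne']
  simp only [gaussianPDFReal, NNReal.coe_one, mul_one, sub_zero]
  have hpi := Real.pi_pos
  rw [mul_pow, ← Real.exp_nat_mul, Real.sqrt_mul (by positivity) (s : ℝ)]
  have : √(s : ℝ) / √(2 * Real.pi) * Real.exp (-(1 - 1 / (2 * s)) * x ^ 2) *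
      ((√(2 * Real.pi) * √(s : ℝ))⁻¹ * Real.exp (-x ^ 2 / (2 * s))) =
      (√(2 * Real.pi))⁻¹ ^ 2 * (Real.exp (-(1 - 1 / (2 * s)) * x ^ 2) * Real.exp (-x ^ 2 / (2 * s))) := by
    field_simp
  rw [this, ← Real.exp_add]
  congr 2
  push_cast
  field_simp
  ring

theorem integrable_gaussian_ratio_sq {s : ℝ≥0} (hs : 1 < s) :
    Integrable (fun x => (gaussianPDFReal 0 1 x / gaussianPDFReal 0 s x) ^ 2)
      (gaussianReal 0 s) := by
  have hs1 : (1 : ℝ) < s := by exact_mod_cast hs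
  have hs0 : s ≠ 0 := by positivity
  rw [gaussianReal_of_var_ne_zero _ hs0,
    integrable_withDensity_iff_integrable_smul₀' (by fun_prop) (by simp [gaussianPDF])]
  simp only [toReal_gaussianPDF, smul_eq_mul, gaussianPDFReal_sq_div hs]
  refine (integrable_exp_neg_mul_sq ?_).const_mul _
  have : 1 / (2 * (s : ℝ)) < 1 := by rw [div_lt_one (by positivity)]; linarith
  linarith

theorem integral_gaussian_ratio_sq_le {s : ℝ≥0} (hs : 1 < s) :
    ∫ x, (gaussianPDFReal 0 1 x / gaussianPDFReal 0 s x) ^ 2 ∂gaussianReal 0 s ≤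
      Real.exp (((s : ℝ) - 1) ^ 2 / 2) := by
  have hs1 : (1 : ℝ) < s := by exact_mod_cast hs
  have hs0 : s ≠ 0 := by positivity
  rw [integral_gaussianReal_eq_integral_smul hs0]
  simp only [smul_eq_mul, gaussianPDFReal_sq_div hs]
  rw [integral_const_mul, integral_gaussian]
  have h1 : (0 : ℝ) < 2 * s - 1 := by linarith
  have hpi := Real.pi_pos
  apply abs_le_of_sq_le_sq' _ (Real.exp_pos _).le |>.2
  rw [mul_pow, div_pow, Real.sq_sqrt (by positivity), Real.sq_sqrt (by positivity),
    Real.sq_sqrt, ← Real.exp_nat_mul]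
  · have e : (s : ℝ) / (2 * Real.pi) * (Real.pi / (1 - 1 / (2 * s))) = s ^ 2 / (2 * s - 1) := by
      have : 1 - 1 / (2 * (s : ℝ)) = (2 * s - 1) / (2 * s) := by field_simp
      rw [this]; field_simp
    rw [e, div_le_iff₀ h1]
    have h2 := Real.add_one_le_exp (((s : ℝ) - 1) ^ 2)
    have h3 : ((2 : ℕ) : ℝ) * (((s : ℝ) - 1) ^ 2 / 2) = ((s : ℝ) - 1) ^ 2 := by push_cast; ring
    rw [h3]
    nlinarith [mul_le_mul_of_nonneg_right h2 h1.le, mul_nonneg (sq_nonneg ((s : ℝ) - 1)) h1.le,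
      mul_nonneg (sq_nonneg ((s : ℝ) - 1)) (sub_pos.2 hs1).le]
  · have : 1 / (2 * (s : ℝ)) < 1 := by rw [div_lt_one (by positivity)]; linarith
    have : 0 < 1 - 1 / (2 * (s : ℝ)) := by linarith
    positivity

/-- Change of variance for an event that depends only on the coordinates in `I`. -/
theorem sq_gaussian_pi_le {n : ℕ} (I : Finset (Fin n)) {σ : ℝ} (hσ : 1 < σ)
    {B : Set (Fin n → ℝ)} (hB : MeasurableSet B)
    (hBI : ∀ x y : Fin n → ℝ, (∀ i ∈ I, x i = y i) → x ∈ B → y ∈ B) :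
    ((Measure.pi fun _ : Fin n => gaussianReal 0 1).real B) ^ 2 ≤
      (Measure.pi fun _ : Fin n => gaussianReal 0 1).real {x | σ • x ∈ B} *
        Real.exp ((σ ^ 2 - 1) ^ 2 / 2) ^ I.card := by
  classical
  set s : ℝ≥0 := NNReal.mk (σ ^ 2) (sq_nonneg _) with hs
  have hs1 : 1 < s := by
    rw [← NNReal.coe_lt_coe]; change (1 : ℝ) < σ ^ 2; nlinarith
  have hs0 : s ≠ 0 := by positivity
  have hmap : (gaussianReal 0 1).map (σ * ·) = gaussianReal 0 s := by
    rw [gaussianReal_map_const_mul]; simp [hs]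
  have hscale : (Measure.pi fun _ : Fin n => gaussianReal 0 1).map (fun x => σ • x) =
      Measure.pi fun _ : Fin n => gaussianReal 0 s := by
    have := Measure.pi_map_pi (μ := fun _ : Fin n => gaussianReal 0 1)
      (f := fun _ x => σ * x) (hμ := fun i => by rw [hmap]; infer_instance)
      (fun i => by fun_prop)
    simp only [hmap] at this
    exact this
  set L : Fin n → ℝ → ℝ := fun i x =>
    if i ∈ I then gaussianPDFReal 0 1 x / gaussianPDFReal 0 s x else 1 with hL
  have hL0 (i : Fin n) (x : ℝ) : 0 ≤ L i x := by
    simp only [hL]; split_ifs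
    · exact div_nonneg (gaussianPDFReal_nonneg _ _ _) (gaussianPDFReal_nonneg _ _ _)
    · exact zero_le_one
  have hL2 (i : Fin n) : Integrable (fun x => L i x ^ 2) (gaussianReal 0 s) := by
    simp only [hL]; split_ifs
    · exact integrable_gaussian_ratio_sq hs1
    · simp
  have hLm (i : Fin n) : Measurable (L i) := by
    simp only [hL]; split_ifs
    · exact (measurable_gaussianPDFReal 0 1).div (measurable_gaussianPDFReal 0 s)
    · fun_prop
  have hLi (i : Fin n) : Integrable (L i) (gaussianReal 0 s) :=
    ((memLp_two_iff_integrable_sq (hLm i).aestronglyMeasurable).2 (hL2 i)).integrable (by norm_num)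
  have hcoord (i : Fin n) : (gaussianReal 0 s).withDensity (fun x => ENNReal.ofReal (L i x)) =
      (gaussianReal 0 1).map (fun x => if i ∈ I then x else σ * x) := by
    by_cases hi : i ∈ I
    · simp only [hL, hi, if_true]
      rw [← gaussianReal_one_eq_withDensity hs0]
      exact Measure.map_id.symm
    · simp only [hL, hi, if_false, hmap]
      simp
  have hmix := sq_pi_withDensity_le (fun _ : Fin n => gaussianReal 0 s) L hL0 hLi hL2 hB
  have hleft : (Measure.pi fun i =>
      (gaussianReal 0 s).withDensity fun x => ENNReal.ofReal (L i x)).real B =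
      (Measure.pi fun _ : Fin n => gaussianReal 0 1).real B := by
    simp only [hcoord]
    have hm (i : Fin n) : Measurable (fun x : ℝ => if i ∈ I then x else σ * x) := by
      split_ifs <;> fun_prop
    have hp (i : Fin n) :
        SigmaFinite ((gaussianReal 0 1).map (fun x : ℝ => if i ∈ I then x else σ * x)) := by
      have := Measure.isProbabilityMeasure_map (μ := gaussianReal 0 1) (hm i).aemeasurable
      infer_instance
    rw [← Measure.pi_map_pi (fun i => (hm i).aemeasurable), map_measureReal_apply _ hB]
    · congr 1
      ext x
      simp only [Set.mem_preimage]
      constructor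
      · exact hBI _ _ fun i hi => by simp [hi]
      · exact hBI _ _ fun i hi => by simp [hi]
    · exact measurable_pi_lambda _ fun i => (hm i).comp (measurable_pi_apply i)
  rw [hleft, ← hscale, map_measureReal_apply (by fun_prop) hB] at hmix
  refine hmix.trans (mul_le_mul_of_nonneg_left ?_ measureReal_nonneg)
  calc ∏ i, ∫ x, L i x ^ 2 ∂gaussianReal 0 s
      ≤ ∏ i, (if i ∈ I then Real.exp ((σ ^ 2 - 1) ^ 2 / 2) else 1) := by
        refine Finset.prod_le_prod (fun i _ => integral_nonneg fun x => sq_nonneg _) fun i _ => ?_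
        by_cases hi : i ∈ I
        · simp only [hL, hi, if_true]
          exact integral_gaussian_ratio_sq_le hs1
        · simp [hL, hi]
    _ = _ := by simp

theorem exists_gaussian_equiv_linearMap {n r : ℕ} (S : (Fin n → ℝ) →ₗ[ℝ] (Fin r → ℝ)) :
    ∃ (T : (Fin n → ℝ) →ₗ[ℝ] (Fin r → ℝ)) (I : Finset (Fin n)), I.card ≤ r ∧
      (∀ x y : Fin n → ℝ, (∀ i ∈ I, x i = y i) → T x = T y) ∧
      (Measure.pi fun _ : Fin n => gaussianReal 0 1).map S =
        (Measure.pi fun _ : Fin n => gaussianReal 0 1).map T := by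
  classical
  let E := EuclideanSpace ℝ (Fin n)
  let S' : E →ₗ[ℝ] (Fin r → ℝ) := S ∘ₗ (WithLp.linearEquiv 2 ℝ (Fin n → ℝ)).toLinearMap
  set k := Module.finrank ℝ (LinearMap.ker S') with hk
  have hrn := S'.finrank_range_add_finrank_ker
  have hn : Module.finrank ℝ E = n := by simp [E]
  have hr : Module.finrank ℝ (LinearMap.range S') ≤ r := by
    simpa using Submodule.finrank_le (LinearMap.range S')
  let b₀ := stdOrthonormalBasis ℝ (LinearMap.ker S')
  let v : Fin n → E := fun i => if h : (i : ℕ) < k then (b₀ ⟨i, h⟩ : E) else 0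
  have hv : Orthonormal ℝ (Set.domRestrict {i : Fin n | (i : ℕ) < k} v) := by
    have h1 : Orthonormal ℝ (fun j => (b₀ j : E)) :=
      b₀.orthonormal.comp_linearIsometry (LinearMap.ker S').subtypeₗᵢ
    have h2 := h1.comp (fun i : {i : Fin n | (i : ℕ) < k} => (⟨i.1, i.2⟩ : Fin k))
      (fun i j hij => by
        ext; simpa using hij)
    convert h2 using 1
    ext1 i
    have : ((i : Fin n) : ℕ) < k := i.2
    simp [v, this]
  obtain ⟨b, hb⟩ := hv.exists_orthonormalBasis_extension_of_card_eq (by simpa using hn)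
  have hbker (i : Fin n) (hi : (i : ℕ) < k) : S' (b i) = 0 := by
    rw [hb i hi]
    simp only [v, hi, dif_pos]
    exact (b₀ ⟨i, hi⟩).2
  let W : (Fin n → ℝ) →ₗ[ℝ] E := Fintype.linearCombination ℝ b
  have hW : ∀ x, W x = ∑ i, x i • b i := fun x => Fintype.linearCombination_apply ℝ b x
  refine ⟨S' ∘ₗ W, Finset.univ.filter fun i => k ≤ (i : ℕ), ?_, ?_, ?_⟩
  · have hc : (Finset.univ.filter fun i : Fin n => k ≤ (i : ℕ)).card +
        (Finset.univ.filter fun i : Fin n => (i : ℕ) < k).card = n := by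
      have := Finset.card_filter_add_card_filter_not (s := (Finset.univ : Finset (Fin n)))
        (fun i => k ≤ (i : ℕ))
      simpa using this
    have hlt : (Finset.univ.filter fun i : Fin n => (i : ℕ) < k).card = k := by
      rw [Fin.card_filter_val_lt]; omega
    omega
  · intro x y hxy
    simp only [LinearMap.comp_apply, hW, map_sum, map_smul]
    refine Finset.sum_congr rfl fun i _ => ?_
    by_cases hi : (i : ℕ) < k
    · simp [hbker i hi]
    · rw [hxy i (by simpa using hi)]
  · have hS'm : Measurable S' := (LinearMap.continuous_of_finiteDimensional S').measurable
    have hWm : Measurable W := (LinearMap.continuous_of_finiteDimensional W).measurable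
    have h1 := stdGaussian_eq_map_pi_orthonormalBasis b
    have h2 := map_pi_eq_stdGaussian (ι := Fin n)
    have e : (fun x => ∑ i, x i • b i) = ⇑W := funext fun x => (hW x).symm
    rw [e, ← h2] at h1
    have h3 := congrArg (Measure.map S') h1
    rw [Measure.map_map hS'm (by fun_prop), Measure.map_map hS'm hWm] at h3
    exact h3

theorem exp_le_one_add_add_sq_mul_exp_abs (y : ℝ) :
    Real.exp y ≤ 1 + y + y ^ 2 * Real.exp |y| := by
  have h := Complex.norm_exp_sub_sum_le_norm_mul_exp (y : ℂ) 2
  have e : Complex.exp y - ∑ m ∈ Finset.range 2, (y : ℂ) ^ m / m.factorial =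
      ((Real.exp y - (1 + y) : ℝ) : ℂ) := by
    simp [Finset.sum_range_succ]
  rw [e, Complex.norm_real, Complex.norm_real, Real.norm_eq_abs, Real.norm_eq_abs, sq_abs] at h
  linarith [le_abs_self (Real.exp y - (1 + y))]

/-- A Bernstein-type upper tail bound for sums of independent centered variables with an
exponential moment. -/
theorem exists_pi_tail_le (μ : Measure ℝ) [IsProbabilityMeasure μ] {Y : ℝ → ℝ}
    (hYm : Measurable Y) (hYi : Integrable Y μ) (hY0 : ∫ x, Y x ∂μ = 0) {θ : ℝ} (hθ : 0 < θ)
    (hexp : Integrable (fun x => Real.exp (2 * θ * |Y x|)) μ) :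
    ∃ a : ℝ, 0 < a ∧ ∀ t : ℝ, 0 < t → t ≤ 1 → ∀ n : ℕ,
      (Measure.pi fun _ : Fin n => μ).real {x | n * t ≤ ∑ i, Y (x i)} ≤
        Real.exp (-(a * (n * t ^ 2))) := by
  set M := ∫ x, Real.exp (2 * θ * |Y x|) ∂μ
  have hM : 0 ≤ M := integral_nonneg fun x => (Real.exp_pos _).le
  set K := 2 / θ ^ 2 * M + 1 / (2 * θ) with hK
  have hK0 : 0 < K := by positivity
  refine ⟨1 / (4 * K), by positivity, fun t ht ht1 n => ?_⟩
  set l := t / (2 * K) with hl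
  have hl0 : 0 < l := by positivity
  have hlθ : l ≤ θ := by
    rw [hl, div_le_iff₀ (by positivity)]
    have : θ * (2 * K) = 4 / θ * M + 1 := by rw [hK]; field_simp; ring
    rw [this]
    have : 0 ≤ 4 / θ * M := by positivity
    linarith
  have hpt (x : ℝ) : Real.exp (l * Y x) ≤
      1 + l * Y x + l ^ 2 * (2 / θ ^ 2) * Real.exp (2 * θ * |Y x|) := by
    have h1 := exp_le_one_add_add_sq_mul_exp_abs (l * Y x)
    have h2 : Real.exp |l * Y x| ≤ Real.exp (θ * |Y x|) := by
      rw [abs_mul, abs_of_pos hl0]; gcongr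
    have h3 : Y x ^ 2 ≤ 2 / θ ^ 2 * Real.exp (θ * |Y x|) := by
      have := Real.quadratic_le_exp_of_nonneg (x := θ * |Y x|) (by positivity)
      rw [div_mul_eq_mul_div, le_div_iff₀ (by positivity)]
      have h5 : (θ * |Y x|) ^ 2 = Y x ^ 2 * θ ^ 2 := by rw [mul_pow, sq_abs]; ring
      have : 0 ≤ θ * |Y x| := by positivity
      nlinarith
    have h4 : (l * Y x) ^ 2 * Real.exp |l * Y x| ≤
        l ^ 2 * (2 / θ ^ 2 * Real.exp (θ * |Y x|)) * Real.exp (θ * |Y x|) := by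
      rw [mul_pow]; gcongr
    have h6 : Real.exp (2 * θ * |Y x|) = Real.exp (θ * |Y x|) * Real.exp (θ * |Y x|) := by
      rw [← Real.exp_add]; ring_nf
    rw [h6]
    linarith
  have hbi : Integrable
      (fun x => 1 + l * Y x + l ^ 2 * (2 / θ ^ 2) * Real.exp (2 * θ * |Y x|)) μ :=
    ((integrable_const _).add (hYi.const_mul _)).add (hexp.const_mul _)
  have hi : Integrable (fun x => Real.exp (l * Y x)) μ := by
    refine hbi.mono' (by fun_prop) (ae_of_all _ fun x => ?_)
    rw [Real.norm_eq_abs, Real.abs_exp]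
    exact hpt x
  have hmgf : ∫ x, Real.exp (l * Y x) ∂μ ≤ Real.exp (l ^ 2 * K) := by
    calc ∫ x, Real.exp (l * Y x) ∂μ
        ≤ ∫ x, (1 + l * Y x + l ^ 2 * (2 / θ ^ 2) * Real.exp (2 * θ * |Y x|)) ∂μ :=
          integral_mono hi hbi hpt
      _ = 1 + l ^ 2 * (2 / θ ^ 2) * M := by
          have h1 : Integrable (fun x => 1 + l * Y x) μ :=
            (integrable_const _).add (hYi.const_mul _)
          rw [integral_add h1 (hexp.const_mul _),
            integral_add (integrable_const _) (hYi.const_mul _), integral_const_mul,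
            integral_const_mul, hY0]
          simp [M]
      _ ≤ 1 + l ^ 2 * K := by
          have : 0 ≤ l ^ 2 * (1 / (2 * θ)) := by positivity
          rw [hK]; linarith
      _ ≤ _ := by linarith [Real.add_one_le_exp (l ^ 2 * K)]
  have hsum : ∀ x : Fin n → ℝ, Real.exp (l * ∑ i, Y (x i)) = ∏ i, Real.exp (l * Y (x i)) := by
    intro x; rw [Finset.mul_sum, Real.exp_sum]
  have hci : Integrable (fun x : Fin n → ℝ => Real.exp (l * ∑ i, Y (x i)))
      (Measure.pi fun _ : Fin n => μ) := by
    simp_rw [hsum]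
    exact Integrable.fintype_prod (f := fun _ x => Real.exp (l * Y x)) fun _ => hi
  have hch := measure_ge_le_exp_mul_mgf (μ := Measure.pi fun _ : Fin n => μ)
    (X := fun x => ∑ i, Y (x i)) (n * t) hl0.le hci
  refine hch.trans ?_
  have hm : mgf (fun x : Fin n → ℝ => ∑ i, Y (x i)) (Measure.pi fun _ : Fin n => μ) l ≤
      Real.exp (l ^ 2 * K) ^ n := by
    rw [mgf]
    simp_rw [hsum]
    rw [integral_fintype_prod_eq_pow fun x => Real.exp (l * Y x), Fintype.card_fin]
    exact pow_le_pow_left₀ (integral_nonneg fun x => (Real.exp_pos _).le) hmgf n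
  refine (mul_le_mul_of_nonneg_left hm (Real.exp_pos _).le).trans ?_
  rw [← Real.exp_nat_mul, ← Real.exp_add]
  refine Real.exp_le_exp.2 (le_of_eq ?_)
  rw [hl]; field_simp; ring

theorem integrable_exp_quarter_sq_gaussianReal :
    Integrable (fun x : ℝ => Real.exp (x ^ 2 / 4)) (gaussianReal 0 1) := by
  rw [gaussianReal_of_var_ne_zero _ one_ne_zero,
    integrable_withDensity_iff_integrable_smul₀' (by fun_prop) (by simp [gaussianPDF])]
  have h := (integrable_exp_neg_mul_sq (b := 1 / 4) (by norm_num)).const_mul (√(2 * Real.pi))⁻¹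
  refine h.congr (ae_of_all _ fun x => ?_)
  simp only [toReal_gaussianPDF, smul_eq_mul, gaussianPDFReal, NNReal.coe_one, mul_one, sub_zero]
  rw [mul_assoc, ← Real.exp_add]
  ring_nf

theorem abs_rpow_le_one_add_sq {p : ℝ} (hp0 : 0 ≤ p) (hp2 : p ≤ 2) (x : ℝ) :
    |x| ^ p ≤ 1 + x ^ 2 := by
  rcases le_total |x| 1 with h | h
  · linarith [Real.rpow_le_one (abs_nonneg x) h hp0, sq_nonneg x]
  · have := Real.rpow_le_rpow_of_exponent_le h hp2
    rw [Real.rpow_two, sq_abs] at this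
    linarith

theorem integrable_abs_rpow_gaussianReal {p : ℝ} (hp0 : 0 ≤ p) (hp2 : p ≤ 2) :
    Integrable (fun x : ℝ => |x| ^ p) (gaussianReal 0 1) := by
  have h2 : Integrable (fun x : ℝ => x ^ 2) (gaussianReal 0 1) :=
    (memLp_id_gaussianReal (μ := 0) (v := 1) 2).integrable_sq
  refine ((integrable_const 1).add h2).mono' (by fun_prop) (ae_of_all _ fun x => ?_)
  rw [Real.norm_eq_abs, abs_of_nonneg (by positivity)]
  exact abs_rpow_le_one_add_sq hp0 hp2 x

theorem integral_abs_rpow_gaussianReal_pos {p : ℝ} (hp0 : 0 ≤ p) (hp2 : p ≤ 2) :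
    0 < ∫ x, |x| ^ p ∂gaussianReal 0 1 := by
  have : NullSingletonClass (gaussianReal 0 1) := nullSingletonClass_gaussianReal one_ne_zero
  refine (integral_pos_iff_support_of_nonneg (fun x => by positivity)
    (integrable_abs_rpow_gaussianReal hp0 hp2)).2 ?_
  have hsub : ({0} : Set ℝ)ᶜ ⊆ Function.support fun x : ℝ => |x| ^ p := by
    intro x hx
    have : 0 < |x| := abs_pos.2 hx
    exact (Real.rpow_pos_of_pos this p).ne'
  refine lt_of_lt_of_le ?_ (measure_mono hsub)
  rw [prob_compl_eq_one_sub (measurableSet_singleton 0)]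
  simp

/-- Concentration of `∑ |g_i| ^ p` for a standard Gaussian vector. -/
theorem exists_gaussian_abs_rpow_tail {p : ℝ} (hp0 : 0 ≤ p) (hp2 : p ≤ 2) :
    ∃ a c : ℝ, 0 < a ∧ 0 < c ∧ ∀ t : ℝ, 0 < t → t ≤ 1 → ∀ n : ℕ,
      (Measure.pi fun _ : Fin n => gaussianReal 0 1).real
          {x | (1 + t) * (n * c) ≤ ∑ i, |x i| ^ p} ≤ Real.exp (-(a * (n * t ^ 2))) ∧
      (Measure.pi fun _ : Fin n => gaussianReal 0 1).real
          {x | ∑ i, |x i| ^ p ≤ (1 - t) * (n * c)} ≤ Real.exp (-(a * (n * t ^ 2))) := by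
  set c := ∫ x, |x| ^ p ∂gaussianReal 0 1 with hc
  have hc0 : 0 < c := integral_abs_rpow_gaussianReal_pos hp0 hp2
  have hint := integrable_abs_rpow_gaussianReal hp0 hp2
  set Y : ℝ → ℝ := fun x => |x| ^ p / c - 1 with hY
  have hYm : Measurable Y := by fun_prop
  have hYi : Integrable Y (gaussianReal 0 1) := (hint.div_const c).sub (integrable_const 1)
  have hY0 : ∫ x, Y x ∂gaussianReal 0 1 = 0 := by
    rw [hY, integral_sub (hint.div_const c) (integrable_const 1), integral_div, ← hc]
    simp [hc0.ne']
  have hexp : Integrable (fun x => Real.exp (2 * (c / 8) * |Y x|)) (gaussianReal 0 1) := by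
    refine (integrable_exp_quarter_sq_gaussianReal.const_mul (Real.exp ((1 + c) / 4))).mono'
      (by fun_prop) (ae_of_all _ fun x => ?_)
    rw [Real.norm_eq_abs, Real.abs_exp, ← Real.exp_add]
    refine Real.exp_le_exp.2 ?_
    have h1 : |Y x| ≤ |x| ^ p / c + 1 := by
      have h2 : 0 ≤ |x| ^ p / c := by positivity
      rw [abs_le]; constructor <;> simp only [hY] <;> linarith
    have h3 : 2 * (c / 8) * |Y x| ≤ 2 * (c / 8) * (|x| ^ p / c + 1) := by gcongr
    have h4 : 2 * (c / 8) * (|x| ^ p / c + 1) = |x| ^ p / 4 + c / 4 := by field_simp; ring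
    linarith [abs_rpow_le_one_add_sq hp0 hp2 x]
  obtain ⟨a₁, ha₁, h₁⟩ := exists_pi_tail_le (gaussianReal 0 1) hYm hYi hY0
    (by positivity : 0 < c / 8) hexp
  obtain ⟨a₂, ha₂, h₂⟩ := exists_pi_tail_le (gaussianReal 0 1) (Y := fun x => -Y x) hYm.neg hYi.neg
    (by rw [integral_neg, hY0, neg_zero]) (by positivity : 0 < c / 8) (by simpa using hexp)
  have hsum (n : ℕ) (x : Fin n → ℝ) : ∑ i, Y (x i) = (∑ i, |x i| ^ p) / c - n := by
    simp [hY, Finset.sum_sub_distrib, Finset.sum_div]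
  refine ⟨min a₁ a₂, c, lt_min ha₁ ha₂, hc0, fun t ht ht1 n => ⟨?_, ?_⟩⟩
  · refine le_trans (le_trans (measureReal_mono fun x hx => ?_) (h₁ t ht ht1 n)) ?_
    · simp only [Set.mem_ofPred_eq, hsum] at hx ⊢
      rw [le_sub_iff_add_le, le_div_iff₀ hc0]
      linarith
    · gcongr; exact min_le_left _ _
  · refine le_trans (le_trans (measureReal_mono fun x hx => ?_) (h₂ t ht ht1 n)) ?_
    · simp only [Set.mem_ofPred_eq, Finset.sum_neg_distrib, hsum] at hx ⊢
      rw [le_neg, sub_le_iff_le_add, div_le_iff₀ hc0]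
      linarith
    · gcongr; exact min_le_right _ _

theorem exists_measure_section_add_le {Ω X : Type*} [MeasurableSpace Ω] [MeasurableSpace X]
    (ρ : Measure Ω) (γ : Measure X) [IsProbabilityMeasure ρ] [IsProbabilityMeasure γ]
    {A₁ A₂ : Set (Ω × X)} (hA₁ : MeasurableSet A₁) (hA₂ : MeasurableSet A₂) {d : ℝ≥0∞}
    (h₁ : ∀ x, ρ {S | (S, x) ∈ A₁} ≤ d) (h₂ : ∀ x, ρ {S | (S, x) ∈ A₂} ≤ d) :
    ∃ S, γ {x | (S, x) ∈ A₁} + γ {x | (S, x) ∈ A₂} ≤ d + d := by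
  have hbound {A : Set (Ω × X)} (hA : MeasurableSet A) (h : ∀ x, ρ {S | (S, x) ∈ A} ≤ d) :
      ∫⁻ S, γ {x | (S, x) ∈ A} ∂ρ ≤ d := by
    have e : ∫⁻ S, γ {x | (S, x) ∈ A} ∂ρ = (ρ.prod γ) A := (Measure.prod_apply hA).symm
    rw [e, Measure.prod_apply_symm hA]
    calc ∫⁻ x, ρ ((fun S => (S, x)) ⁻¹' A) ∂γ ≤ ∫⁻ _, d ∂γ := lintegral_mono fun x => h x
      _ = d := by simp
  have hm₁ : Measurable fun S => γ {x | (S, x) ∈ A₁} := measurable_measure_prodMk_left hA₁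
  have hm₂ : Measurable fun S => γ {x | (S, x) ∈ A₂} := measurable_measure_prodMk_left hA₂
  obtain ⟨S, hS⟩ := exists_le_lintegral (μ := ρ) (hm₁.add hm₂).aemeasurable
  refine ⟨S, hS.trans ?_⟩
  simp only [Pi.add_apply]
  rw [lintegral_add_left hm₁]
  exact add_le_add (hbound hA₁ h₁) (hbound hA₂ h₂)

/-- Testing a linear image of `g` against the same image of `σ • g`, for a standard Gaussian `g`:
a test that is reliable in both cases needs many output coordinates. -/
theorem sq_gaussian_linearMap_le {n r : ℕ} (S : (Fin n → ℝ) →ₗ[ℝ] (Fin r → ℝ)) {σ : ℝ}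
    (hσ : 1 < σ) {A : Set (Fin r → ℝ)} (hA : MeasurableSet A) :
    ((Measure.pi fun _ : Fin n => gaussianReal 0 1).real {x | S x ∈ A}) ^ 2 ≤
      (Measure.pi fun _ : Fin n => gaussianReal 0 1).real {x | S (σ • x) ∈ A} *
        Real.exp ((σ ^ 2 - 1) ^ 2 / 2) ^ r := by
  obtain ⟨T, I, hI, hTI, hST⟩ := exists_gaussian_equiv_linearMap S
  have hSm : Measurable S := (LinearMap.continuous_of_finiteDimensional S).measurable
  have hTm : Measurable T := (LinearMap.continuous_of_finiteDimensional T).measurable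
  have htransfer {A : Set (Fin r → ℝ)} (hA : MeasurableSet A) :
      (Measure.pi fun _ : Fin n => gaussianReal 0 1).real {x | S x ∈ A} =
        (Measure.pi fun _ : Fin n => gaussianReal 0 1).real {x | T x ∈ A} := by
    have h := congrArg (fun m : Measure (Fin r → ℝ) => m.real A) hST
    simp only [map_measureReal_apply hSm hA, map_measureReal_apply hTm hA] at h
    exact h
  have hA' : MeasurableSet {v : Fin r → ℝ | σ • v ∈ A} := (measurable_const_smul σ) hA
  have h := sq_gaussian_pi_le I hσ (hTm hA) fun x y hxy hx => by
    simpa only [Set.mem_preimage, hTI x y hxy] using hx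
  have h1 := htransfer hA
  have h2 := htransfer hA'
  simp only [Set.mem_ofPred_eq, ← map_smul] at h2
  rw [h1, h2]
  refine h.trans (mul_le_mul_of_nonneg_left ?_ measureReal_nonneg)
  exact pow_le_pow_right₀ (Real.one_le_exp (by positivity)) hI

theorem Fp_smul (p : ℝ) {n : ℕ} {σ : ℝ} (hσ : 0 ≤ σ) (x : Fin n → ℝ) :
    Fp p (σ • x) = σ ^ p * Fp p x := by
  simp only [Fp, Pi.smul_apply, smul_eq_mul, abs_mul, abs_of_nonneg hσ, Finset.mul_sum,
    Real.mul_rpow hσ (abs_nonneg _)]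

theorem Fp_nonneg (p : ℝ) {n : ℕ} (x : Fin n → ℝ) : 0 ≤ Fp p x :=
  Finset.sum_nonneg fun _ _ => by positivity

theorem measurable_Fp (p : ℝ) {n : ℕ} : Measurable (Fp p : (Fin n → ℝ) → ℝ) := by
  unfold Fp; fun_prop

/-- Some fixed matrix in a sketching scheme fails with probability at most `2δ` in total on a
random vector and on its multiple by `σ`. -/
theorem IsSketchingScheme.exists_matrix {p : ℝ} {n r : ℕ} {ε δ : ℝ} (hδ : 0 ≤ δ)
    {ρ : Measure (Fin r → Fin n → ℝ)} {f : (Fin r → Fin n → ℝ) → (Fin r → ℝ) → ℝ}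
    (h : IsSketchingScheme p n r ε δ ρ f) (γ : Measure (Fin n → ℝ)) [IsProbabilityMeasure γ]
    (σ : ℝ) :
    ∃ S : (Fin n → ℝ) →ₗ[ℝ] (Fin r → ℝ), ∃ g : (Fin r → ℝ) → ℝ, Measurable g ∧
      γ.real {x | ε * Fp p x < |g (S x) - Fp p x|} +
        γ.real {x | ε * Fp p (σ • x) < |g (S (σ • x)) - Fp p (σ • x)|} ≤ 2 * δ := by
  obtain ⟨hρ, hf, hx⟩ := h
  have hFp := measurable_Fp p (n := n)
  have hprod : Measurable fun q : (Fin r → Fin n → ℝ) × (Fin n → ℝ) =>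
      fun k => ∑ i, q.1 k i * q.2 i :=
    measurable_pi_lambda _ fun k => Finset.measurable_sum _ fun i _ => by fun_prop
  have hsk : Measurable fun q : (Fin r → Fin n → ℝ) × (Fin n → ℝ) =>
      f q.1 (fun k => ∑ i, q.1 k i * q.2 i) :=
    hf.comp (measurable_fst.prodMk hprod)
  set A₁ : Set ((Fin r → Fin n → ℝ) × (Fin n → ℝ)) :=
    {q | ε * Fp p q.2 < |f q.1 (fun k => ∑ i, q.1 k i * q.2 i) - Fp p q.2|} with hA₁
  have hA₁m : MeasurableSet A₁ :=
    measurableSet_lt (by fun_prop) (continuous_abs.measurable.comp (hsk.sub (by fun_prop)))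
  have hscale : Measurable fun q : (Fin r → Fin n → ℝ) × (Fin n → ℝ) => (q.1, σ • q.2) := by
    fun_prop
  have hbad (x : Fin n → ℝ) : ρ {S | (S, x) ∈ A₁} ≤ ENNReal.ofReal δ := by
    have hm : MeasurableSet {S | (S, x) ∈ A₁} := measurable_prodMk_right hA₁m
    have e : {S | (S, x) ∈ A₁} =
        {S | |f S (fun k => ∑ i, S k i * x i) - Fp p x| ≤ ε * Fp p x}ᶜ := by
      ext S; simp [hA₁]
    have hm' : MeasurableSet
        {S | |f S (fun k => ∑ i, S k i * x i) - Fp p x| ≤ ε * Fp p x} := by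
      rw [← MeasurableSet.compl_iff, ← e]; exact hm
    rw [e, prob_compl_eq_one_sub hm']
    calc 1 - _ ≤ 1 - ENNReal.ofReal (1 - δ) := tsub_le_tsub_left (hx x) 1
      _ ≤ ENNReal.ofReal δ := by
        rw [tsub_le_iff_right, ← ENNReal.ofReal_one]
        refine le_trans (ENNReal.ofReal_le_ofReal (by linarith)) ENNReal.ofReal_add_le
  obtain ⟨S, hS⟩ := exists_measure_section_add_le ρ γ hA₁m (hscale hA₁m) hbad
    fun x => hbad (σ • x)
  refine ⟨Matrix.mulVecLin (Matrix.of S), f S, hf.comp measurable_prodMk_left, ?_⟩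
  rw [← ENNReal.ofReal_add hδ hδ] at hS
  have := ENNReal.toReal_le_of_le_ofReal (by linarith) hS
  rw [ENNReal.toReal_add (measure_ne_top _ _) (measure_ne_top _ _)] at this
  rw [two_mul]
  exact this

/-- Lower bound `Ω(ε⁻² log(1/δ))` on the sketching dimension for `F_p`, `1 ≤ p < 2`. -/
theorem fp_sketching_dimension_lower_bound_small_p (p : ℝ) (hp1 : 1 ≤ p) (hp2 : p < 2) :
    ∃ κ C₀ δ₀ : ℝ, 0 < κ ∧ 0 < C₀ ∧ 0 < δ₀ ∧ δ₀ < 1 ∧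
      ∀ ε δ : ℝ, 0 < ε → ε < 1 / 2 → 0 < δ → δ < δ₀ →
      ∀ n r : ℕ, C₀ * ε ^ (-2 : ℝ) * Real.log (1 / δ) ≤ (n : ℝ) →
        ∀ (ρ : Measure (Fin r → Fin n → ℝ))
          (f : (Fin r → Fin n → ℝ) → (Fin r → ℝ) → ℝ),
          IsSketchingScheme p n r ε δ ρ f →
          κ * ε ^ (-2 : ℝ) * Real.log (1 / δ) ≤ (r : ℝ) := by
  obtain ⟨a, c, ha, hc, htail⟩ := exists_gaussian_abs_rpow_tail (by linarith : 0 ≤ p) hp2.le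
  refine ⟨1 / 25600, 1 / a, 1 / 144, by norm_num, by positivity, by norm_num, by norm_num, ?_⟩
  intro ε δ hε hε2 hδ hδ0 n r hn ρ f hsketch
  have hpow : ε ^ (-2 : ℝ) = 1 / ε ^ 2 := by
    rw [Real.rpow_neg hε.le, Real.rpow_two, one_div]
  rw [hpow] at hn ⊢
  set γ := Measure.pi fun _ : Fin n => gaussianReal 0 1
  set σ := (1 + 4 * ε) ^ 2 with hσ
  have hσ1 : 1 < σ := by nlinarith
  have htδ : Real.exp (-(a * (n * ε ^ 2))) ≤ δ := by
    have h1 : Real.log (1 / δ) ≤ a * (n * ε ^ 2) := by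
      have h2 : 1 / a * (1 / ε ^ 2) * Real.log (1 / δ) = Real.log (1 / δ) / (a * ε ^ 2) := by
        field_simp
      rw [h2, div_le_iff₀ (by positivity)] at hn
      linarith
    rw [one_div, Real.log_inv] at h1
    calc _ ≤ Real.exp (Real.log δ) := Real.exp_le_exp.2 (by linarith)
      _ = δ := Real.exp_log hδ
  obtain ⟨hup, hlow⟩ := htail ε hε (by linarith) n
  obtain ⟨S, g, hg, hbad⟩ := hsketch.exists_matrix hδ.le γ σ
  have hnc : 0 ≤ n * c := by positivity
  set A : Set (Fin r → ℝ) := {v | g v ≤ (1 + ε) * ((1 + ε) * (n * c))} with hA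
  have hAm : MeasurableSet A := measurableSet_le hg measurable_const
  have hSm : Measurable S := (LinearMap.continuous_of_finiteDimensional S).measurable
  have hsmall : γ.real {x | S x ∈ A}ᶜ ≤ γ.real {x | ε * Fp p x < |g (S x) - Fp p x|} + δ := by
    refine (measureReal_mono fun x hx => ?_).trans
      ((measureReal_union_le _ _).trans (add_le_add_right (hup.trans htδ) _))
    by_contra hcon
    simp only [Set.mem_union, Set.mem_ofPred_eq, not_or, not_lt, not_le] at hcon
    obtain ⟨h1, h2⟩ := hcon
    change Fp p x < _ at h2
    refine hx ?_
    change g (S x) ≤ _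
    have h3 := (abs_le.1 h1).2
    calc g (S x) ≤ (1 + ε) * Fp p x := by linarith
      _ ≤ _ := by gcongr
  have hlarge : γ.real {x | S (σ • x) ∈ A} ≤
      γ.real {x | ε * Fp p (σ • x) < |g (S (σ • x)) - Fp p (σ • x)|} + δ := by
    refine (measureReal_mono fun x hx => ?_).trans
      ((measureReal_union_le _ _).trans (add_le_add_right (hlow.trans htδ) _))
    by_contra hcon
    simp only [Set.mem_union, Set.mem_ofPred_eq, not_or, not_lt, not_le] at hcon
    obtain ⟨h1, h2⟩ := hcon
    change _ < Fp p x at h2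
    change g (S (σ • x)) ≤ _ at hx
    have h3 := (abs_le.1 h1).1
    rw [Fp_smul p (by linarith) x] at h3
    have h4 : σ * Fp p x ≤ σ ^ p * Fp p x := by
      refine mul_le_mul_of_nonneg_right ?_ (Fp_nonneg p x)
      exact Real.self_le_rpow_of_one_le hσ1.le hp1
    have h5 : (1 - ε) * (σ * ((1 - ε) * (n * c))) < g (S (σ • x)) := by
      calc (1 - ε) * (σ * ((1 - ε) * (n * c))) < (1 - ε) * (σ * Fp p x) := by
            refine mul_lt_mul_of_pos_left (mul_lt_mul_of_pos_left h2 ?_) ?_ <;> linarith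
        _ ≤ (1 - ε) * (σ ^ p * Fp p x) := by
            refine mul_le_mul_of_nonneg_left h4 ?_; linarith
        _ ≤ _ := by linarith
    have h6 : (1 + ε) ^ 2 ≤ ((1 - ε) * (1 + 4 * ε)) ^ 2 :=
      pow_le_pow_left₀ (by linarith) (by nlinarith) 2
    have h7 := mul_le_mul_of_nonneg_right h6 hnc
    rw [mul_pow, ← hσ] at h7
    linarith
  have htest := sq_gaussian_linearMap_le S hσ1 hAm
  have hone : γ.real {x | S x ∈ A} = 1 - γ.real {x | S x ∈ A}ᶜ := by
    have := probReal_compl_eq_one_sub (μ := γ) (hSm hAm)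
    change γ.real {x | S x ∈ A}ᶜ = 1 - γ.real {x | S x ∈ A} at this
    linarith
  have hn1 : 0 ≤ γ.real {x | ε * Fp p x < |g (S x) - Fp p x|} := measureReal_nonneg
  have hn2 : 0 ≤ γ.real {x | ε * Fp p (σ • x) < |g (S (σ • x)) - Fp p (σ • x)|} :=
    measureReal_nonneg
  have hhalf : 1 / 2 ≤ γ.real {x | S x ∈ A} := by linarith
  have hlarge' : γ.real {x | S (σ • x) ∈ A} ≤ 3 * δ := by linarith
  have hexp : Real.exp ((σ ^ 2 - 1) ^ 2 / 2) ^ r ≤ Real.exp (r * (12800 * ε ^ 2)) := by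
    rw [← Real.exp_nat_mul]
    have h1 : σ ^ 2 - 1 ≤ 160 * ε := by
      have : σ ^ 2 - 1 = 16 * ε + 96 * ε ^ 2 + 256 * ε ^ 3 + 256 * ε ^ 4 := by rw [hσ]; ring
      have h2 : ε ^ 2 ≤ 1 / 2 * ε := by nlinarith
      have h3 : ε ^ 3 ≤ 1 / 4 * ε := by nlinarith
      have h4 : ε ^ 4 ≤ 1 / 8 * ε := by nlinarith
      linarith
    have h2 : (σ ^ 2 - 1) ^ 2 ≤ (160 * ε) ^ 2 := pow_le_pow_left₀ (by nlinarith) h1 2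
    gcongr
    linarith
  have hfinal : 1 / δ ≤ Real.exp (r * (12800 * ε ^ 2)) ^ 2 := by
    set X := Real.exp (r * (12800 * ε ^ 2))
    have hX : 0 < X := Real.exp_pos _
    have h1 : 1 / 4 ≤ 3 * δ * X := by
      calc (1 / 4 : ℝ) = (1 / 2) ^ 2 := by norm_num
        _ ≤ (γ.real {x | S x ∈ A}) ^ 2 := by gcongr
        _ ≤ _ := htest
        _ ≤ 3 * δ * X := by gcongr
    have h2 : (1 / 4) ^ 2 ≤ (3 * δ * X) ^ 2 := by gcongr
    rw [div_le_iff₀ hδ]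
    have h3 : 0 ≤ δ * X ^ 2 := by positivity
    nlinarith
  have hlog := Real.log_le_log (by positivity) hfinal
  rw [Real.log_pow, Real.log_exp] at hlog
  push_cast at hlog
  have e : 1 / 25600 * (1 / ε ^ 2) * Real.log (1 / δ) = Real.log (1 / δ) / (25600 * ε ^ 2) := by
    field_simp
  rw [e, div_le_iff₀ (by positivity)]
  linarith
end

section
/- Let p be a real number with 1 ≤ p < 2, let n ≥ 1 be an integer, and let x be a random vector distributed according to the standard Gaussian measure N(0, I_n) on ℝⁿ. Let E_n = E[‖x‖_p] (which is finite). Then for all real t ≥ 0, Pr[ |‖x‖_p − E_n| ≥ t ] ≤ 2 e^{−t² / (2 n^{2/p − 1})}. -/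
open MeasureTheory ProbabilityTheory

/-- `‖x‖_p = (∑ i |x_i|^p)^{1/p}`. -/
noncomputable def pnorm (p : ℝ) {n : ℕ} (x : Fin n → ℝ) : ℝ := (∑ i, |x i| ^ p) ^ (1 / p)

open scoped ENNReal NNReal Pointwise

/-- The one-dimensional Brunn–Minkowski inequality. -/
theorem volume_add_volume_le_volume_add {A B : Set ℝ} (hA : MeasurableSet A)
    (hB : MeasurableSet B) (hA0 : A.Nonempty) (hB0 : B.Nonempty) :
    volume A + volume B ≤ volume (A + B) := by
  have key : ∀ K L : Set ℝ, IsCompact K → IsCompact L → K.Nonempty → L.Nonempty →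
      volume K + volume L ≤ volume (K + L) := by
    intro K L hK hL hK0 hL0
    obtain ⟨a, haK, ha⟩ := hK.exists_isGreatest hK0
    obtain ⟨b, hbL, hb⟩ := hL.exists_isLeast hL0
    have h1 : volume ((fun x => x + b) '' K) = volume K := by simp
    have h2 : volume ((fun x => a + x) '' L) = volume L := by simp
    have hdisj : AEDisjoint volume ((fun x => x + b) '' K) ((fun x => a + x) '' L) := by
      refine measure_mono_null (t := {a + b}) ?_ (by simp)
      rintro _ ⟨⟨x, hx, rfl⟩, ⟨y, hy, hxy⟩⟩
      have := ha hx
      have := hb hy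
      simp only [Set.mem_singleton_iff]
      dsimp only at hxy
      linarith
    have hm : MeasurableSet ((fun x => a + x) '' L) :=
      (hL.image (by fun_prop)).measurableSet
    rw [← h1, ← h2, ← measure_union₀ hm.nullMeasurableSet hdisj]
    refine measure_mono (Set.union_subset ?_ ?_)
    · rintro _ ⟨x, hx, rfl⟩
      exact Set.add_mem_add hx hbL
    · rintro _ ⟨x, hx, rfl⟩
      exact Set.add_mem_add haK hx
  obtain ⟨a, ha⟩ := hA0
  obtain ⟨b, hb⟩ := hB0
  rw [hA.measure_eq_iSup_isCompact, hB.measure_eq_iSup_isCompact]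
  simp only [iSup_and']
  refine ENNReal.biSup_add_biSup_le' ⟨∅, by simp⟩ ⟨∅, by simp⟩ ?_
  rintro K ⟨hKA, hK⟩ L ⟨hLB, hL⟩
  calc volume K + volume L ≤ volume (insert a K) + volume (insert b L) := by
        gcongr <;> exact Set.subset_insert _ _
    _ ≤ volume (insert a K + insert b L) :=
        key _ _ (hK.insert a) (hL.insert b) (Set.insert_nonempty _ _) (Set.insert_nonempty _ _)
    _ ≤ volume (A + B) := measure_mono (Set.add_subset_add
        (Set.insert_subset ha hKA) (Set.insert_subset hb hLB))

theorem volume_weighted_add_le {s t : ℝ} (hs : 0 < s) (ht : 0 < t) {A B C : Set ℝ}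
    (hA : MeasurableSet A) (hB : MeasurableSet B) (hA0 : A.Nonempty) (hB0 : B.Nonempty)
    (hC : ∀ x ∈ A, ∀ y ∈ B, s * x + t * y ∈ C) :
    ENNReal.ofReal s * volume A + ENNReal.ofReal t * volume B ≤ volume C := by
  have h := volume_add_volume_le_volume_add (hA.const_smul_of_ne_zero hs.ne')
    (hB.const_smul_of_ne_zero ht.ne') hA0.smul_set hB0.smul_set
  simp only [Measure.addHaar_smul, Module.finrank_self, pow_one, abs_of_pos hs, abs_of_pos ht] at h
  refine h.trans (measure_mono ?_)
  rintro _ ⟨_, ⟨x, hx, rfl⟩, _, ⟨y, hy, rfl⟩, rfl⟩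
  exact hC x hx y hy


/-- The additive form of the one-dimensional Prékopa–Leindler inequality, for functions of supremum `1`. -/
theorem lintegral_weighted_add_le {s t : ℝ} (hs : 0 < s) (ht : 0 < t) (hst : s + t = 1)
    {u v w : ℝ → ℝ≥0∞} (hu : Measurable u) (hv : Measurable v) (hw : Measurable w)
    (hu1 : ∀ x, u x ≤ 1) (hv1 : ∀ x, v x ≤ 1)
    (hu_sup : ∀ r < 1, ∃ x, r < u x) (hv_sup : ∀ r < 1, ∃ x, r < v x)
    (h : ∀ x y, u x ^ s * v y ^ t ≤ w (s * x + t * y)) :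
    ENNReal.ofReal s * (∫⁻ x, u x) + ENNReal.ofReal t * (∫⁻ x, v x) ≤ ∫⁻ x, w x := by
  have layer : ∀ f : ℝ → ℝ≥0∞, Measurable f → (∀ x, f x ≤ 1) →
      ∫⁻ x, f x = ∫⁻ r in Set.Ioi (0 : ℝ), volume {x | ENNReal.ofReal r < f x} := by
    intro f hf hf1
    have hfin : ∀ x, f x ≠ ∞ := fun x => ((hf1 x).trans_lt ENNReal.one_lt_top).ne
    have := lintegral_eq_lintegral_meas_lt (f := fun x => (f x).toReal) volume
      (Filter.Eventually.of_forall fun _ => ENNReal.toReal_nonneg) hf.ennreal_toReal.aemeasurable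
    simp only [ENNReal.ofReal_toReal (hfin _)] at this
    rw [this]
    refine setLIntegral_congr_fun measurableSet_Ioi fun r hr => ?_
    simp only [ENNReal.ofReal_lt_iff_lt_toReal (le_of_lt hr) (hfin _)]
  have hmeas : ∀ f : ℝ → ℝ≥0∞, Measurable fun r : ℝ => volume {x | ENNReal.ofReal r < f x} := by
    intro f
    refine Antitone.measurable fun r r' hr => measure_mono fun x hx => ?_
    exact (ENNReal.ofReal_le_ofReal hr).trans_lt hx
  have hw_min : ∫⁻ x, min (w x) 1 ≤ ∫⁻ x, w x := lintegral_mono fun x => min_le_left _ _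
  refine le_trans ?_ hw_min
  rw [layer u hu hu1, layer v hv hv1, layer _ (hw.min measurable_const) fun x => min_le_right _ _,
    ← lintegral_const_mul _ (hmeas _), ← lintegral_const_mul _ (hmeas _),
    ← lintegral_add_left ((hmeas _).const_mul _)]
  refine setLIntegral_mono (hmeas _) fun r hr => ?_
  rcases lt_or_ge r 1 with hr1 | hr1
  · have hr1' : ENNReal.ofReal r < 1 := by simpa using hr1
    refine volume_weighted_add_le hs ht (measurableSet_lt measurable_const hu)
      (measurableSet_lt measurable_const hv) (hu_sup _ hr1') (hv_sup _ hr1') fun x hx y hy => ?_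
    refine lt_min (lt_of_lt_of_le ?_ (h x y)) hr1'
    have h0 : ENNReal.ofReal r ≠ 0 := by simpa using hr
    calc ENNReal.ofReal r = ENNReal.ofReal r ^ s * ENNReal.ofReal r ^ t := by
          rw [← ENNReal.rpow_add _ _ h0 ENNReal.ofReal_ne_top, hst, ENNReal.rpow_one]
      _ < u x ^ s * v y ^ t :=
          ENNReal.mul_lt_mul (ENNReal.rpow_lt_rpow hx hs) (ENNReal.rpow_lt_rpow hy ht)
  · have hempty : ∀ f : ℝ → ℝ≥0∞, (∀ x, f x ≤ 1) → {x | ENNReal.ofReal r < f x} = ∅ := by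
      intro f hf
      ext x
      simpa using (hf x).trans (by simpa using hr1)
    simp [hempty u hu1, hempty v hv1]

theorem ENNReal.rpow_mul_rpow_le_weighted_add {s t : ℝ} (hs : 0 < s) (ht : 0 < t)
    (hst : s + t = 1) (X Y : ℝ≥0∞) :
    X ^ s * Y ^ t ≤ ENNReal.ofReal s * X + ENNReal.ofReal t * Y := by
  have hs' : ENNReal.ofReal s ≠ 0 := by simpa using hs
  have ht' : ENNReal.ofReal t ≠ 0 := by simpa using ht
  rcases eq_or_ne X ∞ with rfl | hX
  · simp [ENNReal.mul_top hs']
  rcases eq_or_ne Y ∞ with rfl | hY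
  · simp [ENNReal.mul_top ht']
  lift X to ℝ≥0 using hX
  lift Y to ℝ≥0 using hY
  have := NNReal.geom_mean_le_arith_mean2_weighted s.toNNReal t.toNNReal X Y
    (by rw [← Real.toNNReal_add hs.le ht.le, hst, Real.toNNReal_one])
  rw [Real.coe_toNNReal _ hs.le, Real.coe_toNNReal _ ht.le] at this
  rw [← ENNReal.coe_rpow_of_nonneg _ hs.le, ← ENNReal.coe_rpow_of_nonneg _ ht.le,
    ENNReal.ofReal, ENNReal.ofReal]
  exact_mod_cast this

theorem prekopa_leindler_of_bounded {s t : ℝ} (hs : 0 < s) (ht : 0 < t) (hst : s + t = 1)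
    {u v w : ℝ → ℝ≥0∞} (hu : Measurable u) (hv : Measurable v) (hw : Measurable w)
    (hu_bdd : ⨆ x, u x ≠ ∞) (hv_bdd : ⨆ x, v x ≠ ∞)
    (h : ∀ x y, u x ^ s * v y ^ t ≤ w (s * x + t * y)) :
    (∫⁻ x, u x) ^ s * (∫⁻ x, v x) ^ t ≤ ∫⁻ x, w x := by
  set a := ⨆ x, u x with ha
  set b := ⨆ x, v x with hb
  rcases eq_or_ne a 0 with ha0 | ha0
  · have : ∀ x, u x = 0 := ENNReal.iSup_eq_zero.1 ha0
    simp [this, hs]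
  rcases eq_or_ne b 0 with hb0 | hb0
  · have : ∀ x, v x = 0 := ENNReal.iSup_eq_zero.1 hb0
    simp [this, ht]
  set c := a⁻¹ ^ s * b⁻¹ ^ t with hc
  have hai : a⁻¹ ≠ ∞ := ENNReal.inv_ne_top.2 ha0
  have hbi : b⁻¹ ≠ ∞ := ENNReal.inv_ne_top.2 hb0
  have hc_top : c ≠ ∞ := ENNReal.mul_ne_top
    (ENNReal.rpow_ne_top_of_nonneg hs.le hai) (ENNReal.rpow_ne_top_of_nonneg ht.le hbi)
  have hc0 : c ≠ 0 := mul_ne_zero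
    (ENNReal.rpow_pos (ENNReal.inv_pos.2 hu_bdd) hai).ne'
    (ENNReal.rpow_pos (ENNReal.inv_pos.2 hv_bdd) hbi).ne'
  have hprod : ∀ X Y : ℝ≥0∞, (X * a⁻¹) ^ s * (Y * b⁻¹) ^ t = X ^ s * Y ^ t * c := by
    intro X Y
    rw [ENNReal.mul_rpow_of_nonneg _ _ hs.le, ENNReal.mul_rpow_of_nonneg _ _ ht.le,
      mul_mul_mul_comm]
  have hle : ∀ f : ℝ → ℝ≥0∞, ⨆ x, f x ≠ 0 → ⨆ x, f x ≠ ∞ → ∀ x, f x * (⨆ x, f x)⁻¹ ≤ 1 := by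
    intro f h0 htop x
    rw [← ENNReal.mul_inv_cancel h0 htop]
    gcongr
    exact le_iSup f x
  have hsup : ∀ f : ℝ → ℝ≥0∞, ⨆ x, f x ≠ 0 → ⨆ x, f x ≠ ∞ →
      ∀ r < 1, ∃ x, r < f x * (⨆ x, f x)⁻¹ := by
    intro f h0 htop r hr
    have : r * ⨆ x, f x < ⨆ x, f x := by
      simpa using ENNReal.mul_lt_mul_left h0 htop hr
    obtain ⟨x, hx⟩ := lt_iSup_iff.1 this
    refine ⟨x, ?_⟩
    rw [← div_eq_mul_inv]
    exact (ENNReal.lt_div_iff_mul_lt (Or.inl h0) (Or.inl htop)).2 hx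
  have main := lintegral_weighted_add_le hs ht hst (hu.mul_const a⁻¹) (hv.mul_const b⁻¹)
    (hw.mul_const c) (hle u ha0 hu_bdd) (hle v hb0 hv_bdd) (hsup u ha0 hu_bdd)
    (hsup v hb0 hv_bdd) fun x y => by
      rw [hprod]
      gcongr
      exact h x y
  have := (ENNReal.rpow_mul_rpow_le_weighted_add hs ht hst _ _).trans main
  rw [lintegral_mul_const _ hu, lintegral_mul_const _ hv, lintegral_mul_const _ hw, hprod] at this
  exact (ENNReal.mul_le_mul_iff_left hc0 hc_top).1 this

/-- The one-dimensional **Prékopa–Leindler inequality**. -/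
theorem prekopa_leindler {s t : ℝ} (hs : 0 < s) (ht : 0 < t) (hst : s + t = 1)
    {u v w : ℝ → ℝ≥0∞} (hu : Measurable u) (hv : Measurable v) (hw : Measurable w)
    (h : ∀ x y, u x ^ s * v y ^ t ≤ w (s * x + t * y)) :
    (∫⁻ x, u x) ^ s * (∫⁻ x, v x) ^ t ≤ ∫⁻ x, w x := by
  have trunc : ∀ f : ℝ → ℝ≥0∞, Measurable f → ∀ q : ℝ, 0 < q →
      (∫⁻ x, f x) ^ q = ⨆ k : ℕ, (∫⁻ x, min (f x) k) ^ q := by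
    intro f hf q hq
    have hmono : Monotone fun (k : ℕ) (x : ℝ) => min (f x) k := by
      intro k l hkl x
      dsimp only
      gcongr
    have hlim : ∀ x, ⨆ k : ℕ, min (f x) (k : ℝ≥0∞) = f x := by
      intro x
      rw [← inf_iSup_eq, ENNReal.iSup_natCast, inf_top_eq]
    calc (∫⁻ x, f x) ^ q = (⨆ k : ℕ, ∫⁻ x, min (f x) k) ^ q := by
          rw [← lintegral_iSup (fun k => hf.min measurable_const) hmono]
          simp only [hlim]
      _ = _ := (ENNReal.orderIsoRpow q hq).map_iSup _
  have hbdd : ∀ (f : ℝ → ℝ≥0∞) (k : ℕ), ⨆ x, min (f x) (k : ℝ≥0∞) ≠ ∞ := fun f k =>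
    ((iSup_le fun x => min_le_right _ _).trans_lt (ENNReal.natCast_lt_top k)).ne
  rw [trunc u hu s hs, trunc v hv t ht, ENNReal.iSup_mul]
  refine iSup_le fun k => ?_
  rw [ENNReal.mul_iSup]
  refine iSup_le fun l => ?_
  refine prekopa_leindler_of_bounded hs ht hst (hu.min measurable_const) (hv.min measurable_const)
    hw (hbdd u k) (hbdd v l) fun x y => le_trans ?_ (h x y)
  gcongr <;> exact min_le_left _ _

theorem gaussianPDF_rpow_mul_rpow {s t : ℝ} (hs : 0 < s) (ht : 0 < t) (hst : s + t = 1)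
    (x y : ℝ) :
    ENNReal.ofReal (Real.exp (s * t * (x - y) ^ 2 / 2)) *
      (gaussianPDF 0 1 x ^ s * gaussianPDF 0 1 y ^ t) = gaussianPDF 0 1 (s * x + t * y) := by
  set c : ℝ := (√(2 * Real.pi * 1))⁻¹ with hc
  have hc0 : 0 < c := by positivity
  have hpdf : ∀ z, gaussianPDFReal 0 1 z = c * Real.exp (-z ^ 2 / 2) := by
    intro z
    simp [gaussianPDFReal, hc]
  have hct : c ^ s * c ^ t = c := by rw [← Real.rpow_add hc0, hst, Real.rpow_one]
  simp only [gaussianPDF]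
  rw [ENNReal.ofReal_rpow_of_nonneg (gaussianPDFReal_nonneg _ _ _) hs.le,
    ENNReal.ofReal_rpow_of_nonneg (gaussianPDFReal_nonneg _ _ _) ht.le,
    ← ENNReal.ofReal_mul (Real.rpow_nonneg (gaussianPDFReal_nonneg _ _ _) _),
    ← ENNReal.ofReal_mul (Real.exp_nonneg _)]
  congr 1
  rw [hpdf, hpdf, hpdf, Real.mul_rpow hc0.le (Real.exp_nonneg _),
    Real.mul_rpow hc0.le (Real.exp_nonneg _), ← Real.exp_mul, ← Real.exp_mul]
  calc _ = (c ^ s * c ^ t) * (Real.exp (s * t * (x - y) ^ 2 / 2) *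
        (Real.exp (-x ^ 2 / 2 * s) * Real.exp (-y ^ 2 / 2 * t))) := by ring
    _ = _ := by
      rw [hct, ← Real.exp_add, ← Real.exp_add]
      congr 2
      obtain rfl : t = 1 - s := by linarith
      ring

theorem gaussianReal_property_tau {s t : ℝ} (hs : 0 < s) (ht : 0 < t) (hst : s + t = 1)
    {u v : ℝ → ℝ≥0∞} (hu : Measurable u) (hv : Measurable v)
    (h : ∀ x y, u x ^ s * v y ^ t ≤ ENNReal.ofReal (Real.exp (s * t * (x - y) ^ 2 / 2))) :
    (∫⁻ x, u x ∂gaussianReal 0 1) ^ s * (∫⁻ x, v x ∂gaussianReal 0 1) ^ t ≤ 1 := by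
  have hφ := measurable_gaussianPDF 0 1
  rw [gaussianReal_of_var_ne_zero _ one_ne_zero, lintegral_withDensity_eq_lintegral_mul _ hφ hu,
    lintegral_withDensity_eq_lintegral_mul _ hφ hv,
    ← lintegral_gaussianPDF_eq_one 0 (v := 1) one_ne_zero]
  refine prekopa_leindler hs ht hst (hφ.mul hu) (hφ.mul hv) hφ fun x y => ?_
  rw [← gaussianPDF_rpow_mul_rpow hs ht hst]
  calc _ = (u x ^ s * v y ^ t) * (gaussianPDF 0 1 x ^ s * gaussianPDF 0 1 y ^ t) := by
        rw [Pi.mul_apply, Pi.mul_apply, ENNReal.mul_rpow_of_nonneg _ _ hs.le,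
          ENNReal.mul_rpow_of_nonneg _ _ ht.le]
        ring
    _ ≤ _ := by
        gcongr
        exact h x y

theorem piFinSuccAbove_symm_eq_cons {n : ℕ} (p : ℝ × (Fin n → ℝ)) :
    (MeasurableEquiv.piFinSuccAbove (fun _ : Fin (n + 1) => ℝ) 0).symm p = Fin.cons p.1 p.2 := by
  simp [MeasurableEquiv.piFinSuccAbove, Fin.consEquiv]

theorem lintegral_pi_fin_succ {n : ℕ} (μ : Measure ℝ) [SigmaFinite μ]
    {f : (Fin (n + 1) → ℝ) → ℝ≥0∞} (hf : Measurable f) :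
    ∫⁻ x, f x ∂(Measure.pi fun _ => μ) =
      ∫⁻ a, ∫⁻ x : Fin n → ℝ, f (Fin.cons a x) ∂(Measure.pi fun _ => μ) ∂μ := by
  have hmp := (measurePreserving_piFinSuccAbove (fun _ : Fin (n + 1) => μ) 0).symm
  rw [← hmp.lintegral_comp hf, lintegral_prod _ (by fun_prop)]
  simp only [piFinSuccAbove_symm_eq_cons]

/-- Weighted form of the infimum-convolution inequality for the standard Gaussian measure. -/
theorem pi_gaussianReal_property_tau {s t : ℝ} (hs : 0 < s) (ht : 0 < t) (hst : s + t = 1)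
    (n : ℕ) {u v : (Fin n → ℝ) → ℝ≥0∞} (hu : Measurable u) (hv : Measurable v)
    (h : ∀ x y, u x ^ s * v y ^ t ≤
      ENNReal.ofReal (Real.exp (s * t * (∑ i, (x i - y i) ^ 2) / 2))) :
    (∫⁻ x, u x ∂(Measure.pi fun _ => gaussianReal 0 1)) ^ s *
      (∫⁻ x, v x ∂(Measure.pi fun _ => gaussianReal 0 1)) ^ t ≤ 1 := by
  induction n with
  | zero => 
    have h0 := h Unique.instInhabited.default Unique.instInhabited.default
    simp only [Finset.univ_eq_empty, Finset.sum_empty, mul_zero, zero_div, Real.exp_zero,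
      ENNReal.ofReal_one] at h0
    simpa only [lintegral_unique, measure_univ, mul_one] using h0
  | succ n ih =>
    have hcons : Measurable fun p : ℝ × (Fin n → ℝ) => (Fin.cons p.1 p.2 : Fin (n + 1) → ℝ) := by
      simp only [← piFinSuccAbove_symm_eq_cons]
      exact MeasurableEquiv.measurable _
    have hcons' : ∀ a : ℝ, Measurable fun x : Fin n → ℝ => (Fin.cons a x : Fin (n + 1) → ℝ) :=
      fun a => hcons.comp measurable_prodMk_left
    rw [lintegral_pi_fin_succ _ hu, lintegral_pi_fin_succ _ hv]
    refine gaussianReal_property_tau hs ht hst (hu.comp hcons).lintegral_prod_right'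
      (hv.comp hcons).lintegral_prod_right' fun a b => ?_
    set q := s * t * (a - b) ^ 2 / 2 with hq
    have hcs : ENNReal.ofReal (Real.exp (-q / s)) ^ s = ENNReal.ofReal (Real.exp (-q)) := by
      rw [ENNReal.ofReal_rpow_of_nonneg (Real.exp_nonneg _) hs.le, ← Real.exp_mul,
        div_mul_cancel₀ _ hs.ne']
    have hcancel : ENNReal.ofReal (Real.exp q) * ENNReal.ofReal (Real.exp (-q)) = 1 := by
      rw [← ENNReal.ofReal_mul (Real.exp_nonneg _), ← Real.exp_add]
      simp
    have hua := hu.comp (hcons' a)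
    have key := ih (hua.const_mul (ENNReal.ofReal (Real.exp (-q / s)))) (hv.comp (hcons' b))
      fun x y => by
        have hxy := h (Fin.cons a x) (Fin.cons b y)
        simp only [Fin.sum_univ_succ, Fin.cons_zero, Fin.cons_succ] at hxy
        rw [ENNReal.mul_rpow_of_nonneg _ _ hs.le, hcs, mul_assoc]
        calc _ ≤ ENNReal.ofReal (Real.exp (-q)) * _ := mul_le_mul_right hxy _
          _ = _ := by
            rw [← ENNReal.ofReal_mul (Real.exp_nonneg _), ← Real.exp_add, hq]
            congr 2
            ring
    rw [lintegral_const_mul _ hua, ENNReal.mul_rpow_of_nonneg _ _ hs.le, hcs, mul_assoc] at key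
    calc _ = ENNReal.ofReal (Real.exp q) * (ENNReal.ofReal (Real.exp (-q)) * _) := by
          rw [← mul_assoc, hcancel, one_mul]
          rfl
      _ ≤ ENNReal.ofReal (Real.exp q) * 1 := mul_le_mul_right key _
      _ = _ := mul_one _

theorem ofReal_exp_integral_le_lintegral {Ω : Type*} [MeasurableSpace Ω] {μ : Measure Ω}
    [IsProbabilityMeasure μ] {f : Ω → ℝ} (hf : Integrable f μ) :
    ENNReal.ofReal (Real.exp (∫ x, f x ∂μ)) ≤ ∫⁻ x, ENNReal.ofReal (Real.exp (f x)) ∂μ := by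
  set m := ∫ x, f x ∂μ with hm
  have hint : Integrable (fun x => Real.exp m * (f x - m + 1)) μ := by fun_prop
  have hval : ∫ x, Real.exp m * (f x - m + 1) ∂μ = Real.exp m := by
    rw [integral_const_mul, integral_add (by fun_prop) (by fun_prop),
      integral_sub hf (by fun_prop), ← hm]
    simp
  calc ENNReal.ofReal (Real.exp m) = ENNReal.ofReal (∫ x, Real.exp m * (f x - m + 1) ∂μ) := by
        rw [hval]
    _ ≤ ENNReal.ofReal (∫ x, max (Real.exp m * (f x - m + 1)) 0 ∂μ) :=
        ENNReal.ofReal_le_ofReal (integral_mono hint hint.pos_part fun x => le_max_left _ _)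
    _ = ∫⁻ x, ENNReal.ofReal (max (Real.exp m * (f x - m + 1)) 0) ∂μ :=
        ofReal_integral_eq_lintegral_ofReal hint.pos_part
          (Filter.Eventually.of_forall fun x => le_max_right _ _)
    _ ≤ _ := by
        refine lintegral_mono fun x => ENNReal.ofReal_le_ofReal (max_le ?_ (Real.exp_nonneg _))
        calc Real.exp m * (f x - m + 1) ≤ Real.exp m * Real.exp (f x - m) := by
              gcongr
              exact Real.add_one_le_exp _
          _ = Real.exp (f x) := by rw [← Real.exp_add]; ring_nf

/-- Bound on the exponential moments of a function with squared Lipschitz constant `V`. -/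
theorem lintegral_exp_mul_le_of_lipschitz {s : ℝ} (hs : 0 < s) (hs1 : s < 1) {n : ℕ}
    {F : (Fin n → ℝ) → ℝ} (hF : Measurable F)
    (hint : Integrable F (Measure.pi fun _ => gaussianReal 0 1)) {V : ℝ} (hV : 0 ≤ V)
    (hlip : ∀ x y, (F x - F y) ^ 2 ≤ V * ∑ i, (x i - y i) ^ 2) {l : ℝ} :
    ∫⁻ x, ENNReal.ofReal (Real.exp (s * l * F x)) ∂(Measure.pi fun _ => gaussianReal 0 1) ≤
      ENNReal.ofReal (Real.exp (s * (l * (∫ x, F x ∂(Measure.pi fun _ => gaussianReal 0 1))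
        + l ^ 2 * V / 2))) := by
  set γ : Measure (Fin n → ℝ) := Measure.pi fun _ => gaussianReal 0 1 with hγ
  set t := 1 - s with ht_def
  have ht : 0 < t := by linarith
  have hst : s + t = 1 := by linarith
  set m := ∫ x, F x ∂γ with hm
  set k := l ^ 2 * V / 2 with hk
  set I := ∫⁻ x, ENNReal.ofReal (Real.exp (s * l * F x)) ∂γ with hI
  have htau := pi_gaussianReal_property_tau hs ht hst n
    (u := fun x => ENNReal.ofReal (Real.exp (-t * l * F x)))
    (v := fun x => ENNReal.ofReal (Real.exp (-(s * k))) * ENNReal.ofReal (Real.exp (s * l * F x)))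
    (by fun_prop) (by fun_prop) fun x y => by
      rw [← ENNReal.ofReal_mul (Real.exp_nonneg _), ← Real.exp_add,
        ENNReal.ofReal_rpow_of_nonneg (Real.exp_nonneg _) hs.le,
        ENNReal.ofReal_rpow_of_nonneg (Real.exp_nonneg _) ht.le, ← Real.exp_mul, ← Real.exp_mul,
        ← ENNReal.ofReal_mul (Real.exp_nonneg _), ← Real.exp_add]
      refine ENNReal.ofReal_le_ofReal (Real.exp_le_exp.2 ?_)
      set S := ∑ i, (x i - y i) ^ 2 with hS
      have hS0 : 0 ≤ S := Finset.sum_nonneg fun i _ => sq_nonneg _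
      have hlin : l * (F y - F x) ≤ l ^ 2 * V / 2 + S / 2 := by
        have hsq : (l * (F y - F x)) ^ 2 ≤ (l ^ 2 * V / 2 + S / 2) ^ 2 := by
          calc (l * (F y - F x)) ^ 2 = l ^ 2 * (F x - F y) ^ 2 := by ring
            _ ≤ l ^ 2 * (V * S) := by
              gcongr
              exact hlip x y
            _ ≤ (l ^ 2 * V / 2 + S / 2) ^ 2 := by
              nlinarith [sq_nonneg (l ^ 2 * V / 2 - S / 2)]
        exact le_of_abs_le (abs_le_of_sq_le_sq hsq (by positivity))
      have := mul_le_mul_of_nonneg_left hlin (mul_pos hs ht).le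
      rw [hk]
      linarith
  rw [lintegral_const_mul _ (by fun_prop), ← hI] at htau
  have hjensen := ofReal_exp_integral_le_lintegral (hint.const_mul (-t * l))
  rw [integral_const_mul, ← hm] at hjensen
  have hle : ENNReal.ofReal (Real.exp (-(s * (l * m + k)))) * I ≤ 1 := by
    refine (ENNReal.rpow_le_rpow_iff ht).1 ?_
    rw [ENNReal.one_rpow]
    refine le_trans (le_of_eq ?_) ((mul_le_mul_left
      (ENNReal.rpow_le_rpow hjensen hs.le) _).trans htau)
    rw [ENNReal.mul_rpow_of_nonneg _ _ ht.le, ENNReal.mul_rpow_of_nonneg _ _ ht.le, ← mul_assoc,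
      ENNReal.ofReal_rpow_of_nonneg (Real.exp_nonneg _) ht.le,
      ENNReal.ofReal_rpow_of_nonneg (Real.exp_nonneg _) ht.le,
      ENNReal.ofReal_rpow_of_nonneg (Real.exp_nonneg _) hs.le,
      ← Real.exp_mul, ← Real.exp_mul, ← Real.exp_mul,
      ← ENNReal.ofReal_mul (Real.exp_nonneg _), ← Real.exp_add]
    congr 3
    ring_nf
  calc I = ENNReal.ofReal (Real.exp (s * (l * m + k))) *
        (ENNReal.ofReal (Real.exp (-(s * (l * m + k)))) * I) := by
        rw [← mul_assoc, ← ENNReal.ofReal_mul (Real.exp_nonneg _), ← Real.exp_add]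
        simp
    _ ≤ ENNReal.ofReal (Real.exp (s * (l * m + k))) * 1 := mul_le_mul_right hle _
    _ = _ := mul_one _

/-- Gaussian concentration above the mean for a function with squared Lipschitz constant `V`. -/
theorem gaussian_upper_deviation_le_of_lipschitz {n : ℕ}
    {F : (Fin n → ℝ) → ℝ} (hF : Measurable F)
    (hint : Integrable F (Measure.pi fun _ => gaussianReal 0 1)) {V : ℝ} (hV : 0 < V)
    (hlip : ∀ x y, (F x - F y) ^ 2 ≤ V * ∑ i, (x i - y i) ^ 2) {r : ℝ} (hr : 0 ≤ r) :
    (Measure.pi fun _ => gaussianReal 0 1)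
      {x | r ≤ F x - ∫ y, F y ∂(Measure.pi fun _ => gaussianReal 0 1)} ≤
      ENNReal.ofReal (Real.exp (-r ^ 2 / (2 * V))) := by
  set γ : Measure (Fin n → ℝ) := Measure.pi fun _ => gaussianReal 0 1 with hγ
  set m := ∫ x, F x ∂γ with hm
  have hbound : ∀ s ∈ Set.Ioo (0 : ℝ) 1,
      γ {x | r ≤ F x - m} ≤ ENNReal.ofReal (Real.exp (s * (-r ^ 2 / (2 * V)))) := by
    rintro s ⟨hs0, hs1⟩
    set l := r / V with hl
    have hl0 : 0 ≤ l := by positivity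
    have hmgf := lintegral_exp_mul_le_of_lipschitz hs0 hs1 hF hint hV.le hlip (l := l)
    set c := ENNReal.ofReal (Real.exp (s * l * (m + r))) with hc
    have hmarkov := mul_meas_ge_le_lintegral (μ := γ)
      (f := fun x => ENNReal.ofReal (Real.exp (s * l * F x))) (by fun_prop) c
    have hsub : {x | r ≤ F x - m} ⊆ {x | c ≤ ENNReal.ofReal (Real.exp (s * l * F x))} := by
      intro x hx
      have hx' : r ≤ F x - m := hx
      refine ENNReal.ofReal_le_ofReal (Real.exp_le_exp.2 ?_)
      gcongr
      linarith
    have h1 : c * γ {x | r ≤ F x - m} ≤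
        ENNReal.ofReal (Real.exp (s * (l * m + l ^ 2 * V / 2))) :=
      (mul_le_mul_right (measure_mono hsub) c).trans (hmarkov.trans hmgf)
    calc γ {x | r ≤ F x - m} = ENNReal.ofReal (Real.exp (-(s * l * (m + r)))) *
          (c * γ {x | r ≤ F x - m}) := by
          rw [hc, ← mul_assoc, ← ENNReal.ofReal_mul (Real.exp_nonneg _), ← Real.exp_add]
          simp
      _ ≤ ENNReal.ofReal (Real.exp (-(s * l * (m + r)))) *
          ENNReal.ofReal (Real.exp (s * (l * m + l ^ 2 * V / 2))) := mul_le_mul_right h1 _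
      _ = _ := by
          rw [← ENNReal.ofReal_mul (Real.exp_nonneg _), ← Real.exp_add, hl]
          congr 2
          field_simp
          ring
  have hlim : Filter.Tendsto (fun s : ℝ => ENNReal.ofReal (Real.exp (s * (-r ^ 2 / (2 * V)))))
      (nhdsWithin 1 (Set.Iio 1)) (nhds (ENNReal.ofReal (Real.exp (-r ^ 2 / (2 * V))))) := by
    have : Continuous fun s : ℝ => ENNReal.ofReal (Real.exp (s * (-r ^ 2 / (2 * V)))) :=
      ENNReal.continuous_ofReal.comp (by fun_prop)
    simpa using (this.tendsto 1).mono_left nhdsWithin_le_nhds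
  exact ge_of_tendsto hlim
    (Filter.eventually_of_mem (Ioo_mem_nhdsLT one_pos) hbound)

theorem pnorm_nonneg (p : ℝ) {n : ℕ} (x : Fin n → ℝ) : 0 ≤ pnorm p x := by
  unfold pnorm
  positivity

theorem measurable_pnorm (p : ℝ) {n : ℕ} : Measurable fun x : Fin n → ℝ => pnorm p x := by
  unfold pnorm
  fun_prop

theorem sq_pnorm_le {p : ℝ} (hp0 : 0 < p) (hp2 : p ≤ 2) {n : ℕ} (x : Fin n → ℝ) :
    pnorm p x ^ 2 ≤ (n : ℝ) ^ (2 / p - 1) * ∑ i, x i ^ 2 := by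
  have h := Real.rpow_sum_le_const_mul_sum_rpow_of_nonneg (s := Finset.univ)
    (f := fun i => |x i| ^ p) ((one_le_div hp0).2 hp2) fun i _ => by positivity
  have hpow : ∀ i, (|x i| ^ p) ^ (2 / p) = x i ^ 2 := by
    intro i
    rw [← Real.rpow_mul (abs_nonneg _), mul_div_cancel₀ _ hp0.ne', Real.rpow_two, sq_abs]
  simp only [hpow, Finset.card_univ, Fintype.card_fin] at h
  refine le_trans (le_of_eq ?_) h
  rw [pnorm, ← Real.rpow_two, ← Real.rpow_mul (by positivity)]
  congr 1
  ring

theorem pnorm_le_pnorm_sub_add {p : ℝ} (hp1 : 1 ≤ p) {n : ℕ} (x y : Fin n → ℝ) :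
    pnorm p x ≤ pnorm p (x - y) + pnorm p y := by
  simpa [pnorm] using Real.Lp_add_le Finset.univ (fun i => x i - y i) y hp1

theorem sq_pnorm_sub_pnorm_le {p : ℝ} (hp1 : 1 ≤ p) (hp2 : p ≤ 2) {n : ℕ} (x y : Fin n → ℝ) :
    (pnorm p x - pnorm p y) ^ 2 ≤ (n : ℝ) ^ (2 / p - 1) * ∑ i, (x i - y i) ^ 2 := by
  have hxy := pnorm_le_pnorm_sub_add hp1 x y
  have hyx := pnorm_le_pnorm_sub_add hp1 y x
  have hsymm : pnorm p (y - x) = pnorm p (x - y) := by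
    simp only [pnorm, Pi.sub_apply, abs_sub_comm]
  refine le_trans ?_ (sq_pnorm_le (by linarith) hp2 (x - y))
  exact sq_le_sq' (by linarith) (by linarith)

theorem integrable_pnorm_pi_gaussianReal {p : ℝ} (hp0 : 0 < p) (hp2 : p ≤ 2) (n : ℕ) :
    Integrable (fun x : Fin n → ℝ => pnorm p x) (Measure.pi fun _ => gaussianReal 0 1) := by
  have hsq : Integrable (fun z : ℝ => z ^ 2) (gaussianReal 0 1) :=
    (memLp_id_gaussianReal 2).integrable_sq
  have hcoord : ∀ i : Fin n, Integrable (fun x : Fin n → ℝ => x i ^ 2)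
      (Measure.pi fun _ => gaussianReal 0 1) := fun i =>
    (measurePreserving_eval (fun _ : Fin n => gaussianReal 0 1) i).integrable_comp_of_integrable hsq
  have hsum : Integrable (fun x : Fin n → ℝ => 1 + (n : ℝ) ^ (2 / p - 1) * ∑ i, x i ^ 2)
      (Measure.pi fun _ => gaussianReal 0 1) :=
    (integrable_const 1).add ((integrable_finsetSum _ fun i _ => hcoord i).const_mul _)
  refine hsum.mono' (measurable_pnorm p).aestronglyMeasurable
    (Filter.Eventually.of_forall fun x => ?_)
  rw [Real.norm_of_nonneg (pnorm_nonneg p x)]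
  nlinarith [sq_pnorm_le hp0 hp2 x, sq_nonneg (pnorm p x - 1)]

/-- Gaussian concentration of the `ℓ_p`-norm, `1 ≤ p < 2`: the expectation
`E_n = E[‖x‖_p]` is finite, and `Pr[|‖x‖_p − E_n| ≥ t] ≤ 2 e^{−t²/(2 n^{2/p − 1})}`. -/
theorem gaussian_pnorm_concentration_small_p (p : ℝ) (hp1 : 1 ≤ p) (hp2 : p < 2)
    (n : ℕ) (hn : 1 ≤ n) :
    Integrable (fun x : Fin n → ℝ => pnorm p x)
      (Measure.pi fun _ : Fin n => gaussianReal 0 1) ∧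
    ∀ t : ℝ, 0 ≤ t →
      (Measure.pi fun _ : Fin n => gaussianReal 0 1)
          {x : Fin n → ℝ |
            t ≤ |pnorm p x -
                ∫ y, pnorm p y ∂(Measure.pi fun _ : Fin n => gaussianReal 0 1)|}
        ≤ ENNReal.ofReal (2 * Real.exp (-t ^ 2 / (2 * (n : ℝ) ^ (2 / p - 1)))) := by
  have hint := integrable_pnorm_pi_gaussianReal (by linarith) hp2.le n (p := p)
  refine ⟨hint, fun t ht => ?_⟩
  have hn' : (0 : ℝ) < n := by exact_mod_cast hn
  have hV : (0 : ℝ) < (n : ℝ) ^ (2 / p - 1) := Real.rpow_pos_of_pos hn' _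
  have hlip := sq_pnorm_sub_pnorm_le hp1 hp2.le (n := n)
  have hup := gaussian_upper_deviation_le_of_lipschitz (measurable_pnorm p) hint hV hlip ht
  have hlow := gaussian_upper_deviation_le_of_lipschitz (measurable_pnorm p).neg hint.neg hV
    (fun x y => by
      simpa only [Pi.neg_apply, neg_sub_neg, ← sub_sq_comm (pnorm p x)] using hlip x y) ht
  simp only [Pi.neg_apply, integral_neg] at hlow
  rw [two_mul (Real.exp _), ENNReal.ofReal_add (Real.exp_nonneg _) (Real.exp_nonneg _)]
  refine le_trans ?_ (add_le_add hup hlow)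
  refine (measure_mono fun x hx => ?_).trans (measure_union_le _ _)
  rcases le_abs.1 (show t ≤ |_| from hx) with h | h
  · exact Or.inl h
  · refine Or.inr ?_
    simp only [Set.mem_ofPred_eq]
    linarith
end

section
/- There exist constants C > 0 and δ₀ ∈ (0,1) such that for all 0 < ε < 1/2, all 0 < δ < δ₀, and every positive integer r with r ≤ C ε^{−2} log(1/δ), the total variation distance between the r-fold product of the one-dimensional Gaussian N(0,1) and the r-fold product of the one-dimensional Gaussian N(0, (1+3ε)²) is at most 1 − δ. -/
open MeasureTheory ProbabilityTheory

/-- Total variation distance between two measures: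
`D_TV(μ, ν) = sup_{A measurable} |μ(A) − ν(A)|`. -/
noncomputable def tvDist {E : Type*} [MeasurableSpace E] (μ ν : Measure E) : ℝ :=
  ⨆ (A : Set E) (_ : MeasurableSet A), |(μ A).toReal - (ν A).toReal|

open scoped ENNReal NNReal

/-- A finite product of measures with densities has the product of the densities as density. -/
lemma pi_withDensity {ι : Type*} [Fintype ι] {α : ι → Type*} [∀ i, MeasurableSpace (α i)]
    (μ : ∀ i, Measure (α i)) [∀ i, IsProbabilityMeasure (μ i)] {f : ∀ i, α i → ℝ≥0∞}
    (hf : ∀ i, Measurable (f i)) [∀ i, SigmaFinite ((μ i).withDensity (f i))] :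
    Measure.pi (fun i => (μ i).withDensity (f i)) =
      (Measure.pi μ).withDensity (fun x => ∏ i, f i (x i)) := by
  refine Measure.pi_eq fun s hs => ?_
  have hind : ∀ i, Measurable ((s i).indicator (f i)) := fun i => (hf i).indicator (hs i)
  rw [withDensity_apply _ (MeasurableSet.univ_pi hs),
    ← lintegral_indicator (MeasurableSet.univ_pi hs)]
  have hprod : (Set.univ.pi s).indicator (fun x : ∀ i, α i => ∏ i, f i (x i)) =
      fun x => ∏ i, (s i).indicator (f i) (x i) := by
    classical
    ext x
    by_cases hx : x ∈ Set.univ.pi s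
    · rw [Set.indicator_of_mem hx]
      exact Finset.prod_congr rfl fun i _ => (Set.indicator_of_mem (hx i trivial) _).symm
    · rw [Set.indicator_of_notMem hx]
      obtain ⟨i, hi⟩ : ∃ i, x i ∉ s i := by simpa [Set.mem_pi] using hx
      exact (Finset.prod_eq_zero (Finset.mem_univ i) (Set.indicator_of_notMem hi _)).symm
  rw [hprod, lintegral_prod_eq_prod_lintegral_of_indepFun Finset.univ
    (fun i (x : ∀ i, α i) => (s i).indicator (f i) (x i))
    (iIndepFun_pi fun i => (hind i).aemeasurable)
    (fun i => (hind i).comp (measurable_pi_apply i))]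
  refine Finset.prod_congr rfl fun i _ => ?_
  rw [(measurePreserving_eval μ i).lintegral_comp (hind i), lintegral_indicator (hs i),
    withDensity_apply _ (hs i)]

/-- Cauchy-Schwarz for two densities whose product is constant. -/
lemma mul_measure_sq_le_withDensity_mul_withDensity {α : Type*} [MeasurableSpace α]
    (γ : Measure α) {f g : α → ℝ≥0∞} (hf : Measurable f) (hg : Measurable g) {K : ℝ≥0∞}
    (hfg : ∀ x, f x * g x = K) {A : Set α} (hA : MeasurableSet A) :
    K * γ A ^ 2 ≤ γ.withDensity f A * γ.withDensity g A := by
  have h := ENNReal.lintegral_mul_le_Lp_mul_Lq (γ.restrict A)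
    (Real.HolderConjugate.two_two)
    (hf.pow_const (1 / 2 : ℝ)).aemeasurable (hg.pow_const (1 / 2 : ℝ)).aemeasurable
  have hK : ∀ x, f x ^ (1 / 2 : ℝ) * g x ^ (1 / 2 : ℝ) = K ^ (1 / 2 : ℝ) := fun x => by
    rw [← ENNReal.mul_rpow_of_nonneg _ _ (by norm_num), hfg]
  simp only [Pi.mul_apply, hK, ← ENNReal.rpow_mul, lintegral_const, Measure.restrict_apply_univ]
    at h
  norm_num at h
  rw [← withDensity_apply _ hA, ← withDensity_apply _ hA,
    ← ENNReal.mul_rpow_of_nonneg _ _ (by norm_num)] at h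
  have h2 := pow_le_pow_left' h 2
  rw [mul_pow, ← ENNReal.rpow_mul_natCast, ← ENNReal.rpow_mul_natCast] at h2
  norm_num at h2
  exact h2

/-- Two probability measures with densities of constant product `K` have total variation distance
at most `1 - K / 2`. -/
lemma tvDist_withDensity_le {α : Type*} [MeasurableSpace α] (γ μ ν : Measure α)
    [IsProbabilityMeasure γ] [IsProbabilityMeasure μ] [IsProbabilityMeasure ν] {f g : α → ℝ≥0∞}
    (hf : Measurable f) (hg : Measurable g) (hμ : μ = γ.withDensity f)
    (hν : ν = γ.withDensity g) {K : ℝ} (hK : 0 ≤ K) (hK1 : K ≤ 1)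
    (hfg : ∀ x, f x * g x = ENNReal.ofReal K) :
    tvDist μ ν ≤ 1 - K / 2 := by
  have hCS : ∀ A, MeasurableSet A → K * γ.real A ^ 2 ≤ μ.real A * ν.real A := fun A hA => by
    have h := mul_measure_sq_le_withDensity_mul_withDensity γ hf hg hfg hA
    rw [← hμ, ← hν] at h
    have h' := ENNReal.toReal_mono (by finiteness) h
    simpa [ENNReal.toReal_mul, ENNReal.toReal_pow, hK, Measure.real] using h'
  have key : ∀ A, MeasurableSet A → μ.real A - ν.real A ≤ 1 - K / 2 := fun A hA => by
    have h1 := hCS A hA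
    have h2 := hCS Aᶜ hA.compl
    rw [probReal_compl_eq_one_sub hA, probReal_compl_eq_one_sub hA,
      probReal_compl_eq_one_sub hA] at h2
    have hm : μ.real A ≤ 1 := measureReal_le_one
    have hn : ν.real A ≤ 1 := measureReal_le_one
    have hm0 : 0 ≤ μ.real A := measureReal_nonneg
    have hn0 : 0 ≤ ν.real A := measureReal_nonneg
    have h3 : K * γ.real A ^ 2 ≤ ν.real A := h1.trans (mul_le_of_le_one_left hn0 hm)
    have h4 : K * (1 - γ.real A) ^ 2 ≤ 1 - μ.real A :=
      h2.trans (mul_le_of_le_one_right (by linarith) (by linarith))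
    nlinarith [mul_nonneg hK (sq_nonneg (2 * γ.real A - 1))]
  have h0 : 0 ≤ 1 - K / 2 := by linarith
  refine Real.iSup_le (fun A => Real.iSup_le (fun hA => ?_) h0) h0
  change |μ.real A - ν.real A| ≤ _
  refine abs_le.2 ⟨?_, key A hA⟩
  have h := key Aᶜ hA.compl
  rw [probReal_compl_eq_one_sub hA, probReal_compl_eq_one_sub hA] at h
  linarith

lemma gaussianReal_eq_withDensity_gaussianReal (m₁ m₂ : ℝ) {v w : ℝ≥0} (hv : v ≠ 0) (hw : w ≠ 0) :
    gaussianReal m₁ v =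
      (gaussianReal m₂ w).withDensity (fun x => gaussianPDF m₁ v x / gaussianPDF m₂ w x) := by
  rw [gaussianReal_of_var_ne_zero _ hv, gaussianReal_of_var_ne_zero _ hw,
    ← withDensity_mul _ (by fun_prop) (by fun_prop)]
  congr 1
  ext x
  exact (ENNReal.mul_div_cancel (gaussianPDF_pos _ hw x).ne' (by simp [gaussianPDF])).symm

/-- If the precision `1 / w` is the average of the precisions `1` and `1 / s ^ 2`, the densities of
`N(0, 1)` and `N(0, s ^ 2)` with respect to `N(0, w)` have a constant product. -/
lemma gaussianPDF_div_mul_gaussianPDF_div {s : ℝ} (hs : 0 < s) (x : ℝ) :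
    gaussianPDF 0 1 x / gaussianPDF 0 (2 * s ^ 2 / (1 + s ^ 2)).toNNReal x *
      (gaussianPDF 0 (s ^ 2).toNNReal x / gaussianPDF 0 (2 * s ^ 2 / (1 + s ^ 2)).toNNReal x) =
      ENNReal.ofReal (2 * s / (1 + s ^ 2)) := by
  have hw : 0 < 2 * s ^ 2 / (1 + s ^ 2) := by positivity
  have hpos := gaussianPDFReal_pos 0 _ x (Real.toNNReal_pos.2 hw).ne'
  simp only [gaussianPDF]
  rw [← ENNReal.ofReal_div_of_pos hpos, ← ENNReal.ofReal_div_of_pos hpos,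
    ← ENNReal.ofReal_mul (div_nonneg (gaussianPDFReal_nonneg _ _ _) hpos.le)]
  congr 1
  rw [div_mul_div_comm, div_eq_iff (by positivity)]
  simp only [gaussianPDFReal, Real.coe_toNNReal _ hw.le, Real.coe_toNNReal _ (sq_nonneg s),
    NNReal.coe_one, sub_zero, mul_one]
  rw [mul_mul_mul_comm, mul_mul_mul_comm (√(2 * Real.pi * (2 * s ^ 2 / (1 + s ^ 2))))⁻¹,
    ← Real.exp_add, ← Real.exp_add, ← mul_assoc,
    ← mul_inv, ← mul_inv, Real.mul_self_sqrt (by positivity), Real.sqrt_mul (by positivity) (s ^ 2),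
    Real.sqrt_sq hs.le, ← mul_assoc, Real.mul_self_sqrt (by positivity)]
  congr 1
  · field_simp
  · congr 1
    field_simp
    ring

/-- The total variation distance between `N(0, 1)^{⊗ ι}` and `N(0, s ^ 2)^{⊗ ι}` is bounded through
their Hellinger affinity. -/
lemma tvDist_pi_gaussianReal_le (ι : Type*) [Fintype ι] {s : ℝ} (hs : 0 < s) :
    tvDist (Measure.pi fun _ : ι => gaussianReal 0 1)
        (Measure.pi fun _ : ι => gaussianReal 0 (s ^ 2).toNNReal) ≤
      1 - (2 * s / (1 + s ^ 2)) ^ Fintype.card ι / 2 := by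
  set w : ℝ≥0 := (2 * s ^ 2 / (1 + s ^ 2)).toNNReal with hw_def
  have hw : w ≠ 0 := (Real.toNNReal_pos.2 (by positivity)).ne'
  have hs2 : (s ^ 2).toNNReal ≠ 0 := (Real.toNNReal_pos.2 (by positivity)).ne'
  have hpi : ∀ v : ℝ≥0, v ≠ 0 → (Measure.pi fun _ : ι => gaussianReal 0 v) =
      (Measure.pi fun _ : ι => gaussianReal 0 w).withDensity
        (fun x => ∏ i, gaussianPDF 0 v (x i) / gaussianPDF 0 w (x i)) := fun v hv => by
    have heq := gaussianReal_eq_withDensity_gaussianReal 0 0 hv hw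
    have : IsProbabilityMeasure ((gaussianReal 0 w).withDensity
        (fun x => gaussianPDF 0 v x / gaussianPDF 0 w x)) := heq ▸ inferInstance
    conv_lhs => rw [heq]
    exact pi_withDensity (fun _ : ι => gaussianReal 0 w)
      (f := fun _ x => gaussianPDF 0 v x / gaussianPDF 0 w x) (fun _ => by fun_prop)
  have hK : 0 ≤ 2 * s / (1 + s ^ 2) := by positivity
  have hK1 : 2 * s / (1 + s ^ 2) ≤ 1 := by
    rw [div_le_one (by positivity)]
    nlinarith [sq_nonneg (s - 1)]
  refine tvDist_withDensity_le _ _ _ (by fun_prop) (by fun_prop) (hpi 1 one_ne_zero)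
    (hpi _ hs2) (pow_nonneg hK _) (pow_le_one₀ hK hK1) fun x => ?_
  rw [← Finset.prod_mul_distrib, Finset.prod_congr rfl fun i _ =>
    gaussianPDF_div_mul_gaussianPDF_div hs (x i), Finset.prod_const, Finset.card_univ,
    ENNReal.ofReal_pow hK]

/-- There are constants `C > 0` and `δ₀ ∈ (0,1)` so that whenever `0 < ε < 1/2`,
`0 < δ < δ₀` and `r ≤ C ε⁻² log(1/δ)`, the total variation distance between
`N(0,1)^{⊗ r}` and `N(0, (1+3ε)²)^{⊗ r}` is at most `1 − δ`. -/
theorem tv_product_gaussians_le :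
    ∃ C δ₀ : ℝ, 0 < C ∧ 0 < δ₀ ∧ δ₀ < 1 ∧
      ∀ ε δ : ℝ, 0 < ε → ε < 1 / 2 → 0 < δ → δ < δ₀ →
      ∀ r : ℕ, 0 < r → (r : ℝ) ≤ C * ε ^ (-2 : ℝ) * Real.log (1 / δ) →
        tvDist (Measure.pi fun _ : Fin r => gaussianReal 0 1)
            (Measure.pi fun _ : Fin r => gaussianReal 0 (Real.toNNReal ((1 + 3 * ε) ^ 2)))
          ≤ 1 - δ := by
  refine ⟨1 / 9, 1 / 4, by norm_num, by norm_num, by norm_num, ?_⟩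
  intro ε δ hε _ hδ hδ₀ r _ hr
  have hs : 0 < 1 + 3 * ε := by linarith
  refine (tvDist_pi_gaussianReal_le (Fin r) hs).trans ?_
  rw [Fintype.card_fin]
  have hexp : Real.exp (-(9 / 2 * ε ^ 2)) ≤ 2 * (1 + 3 * ε) / (1 + (1 + 3 * ε) ^ 2) := by
    rw [Real.exp_neg, inv_le_comm₀ (Real.exp_pos _) (by positivity), inv_div]
    refine le_trans ?_ (Real.add_one_le_exp _)
    rw [div_le_iff₀ (by positivity)]
    nlinarith [pow_pos hε 3]
  have hr' : ε ^ 2 * r ≤ 1 / 9 * Real.log (1 / δ) := by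
    rw [Real.rpow_neg hε.le, Real.rpow_two] at hr
    calc ε ^ 2 * r ≤ ε ^ 2 * (1 / 9 * (ε ^ 2)⁻¹ * Real.log (1 / δ)) := by gcongr
      _ = 1 / 9 * Real.log (1 / δ) := by field_simp
  have hsqrt : √δ ≤ (2 * (1 + 3 * ε) / (1 + (1 + 3 * ε) ^ 2)) ^ r := by
    refine le_trans ?_ (pow_le_pow_left₀ (Real.exp_pos _).le hexp r)
    rw [← Real.exp_nat_mul, ← Real.log_le_iff_le_exp (Real.sqrt_pos.2 hδ), Real.log_sqrt hδ.le]
    rw [one_div δ, Real.log_inv] at hr'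
    linarith
  have hδ_sqrt : 2 * δ ≤ √δ := Real.le_sqrt_of_sq_le (by nlinarith)
  linarith
end

section
/- Fix an integer n ≥ 1, a vector x ∈ ℝⁿ, and a real number p > 2. Then for all positive integers S₁ and S₂, Q(S₁, S₂) ≤ R(S₁ + S₂). -/
open Finset

/-- `R(S) = Σ_{q=1}^{⌊S/2⌋} Σ_{compositions (h₁,…,h_q) of S with parts ≥ 2}
[S!/(h₁!⋯h_q!)] · Σ_{i₁<⋯<i_q} ∏_r |x_{i_r}|^{(p−1)h_r} · ∏_r h_r^{h_r/2}`.
Compositions of `S` into `q` parts are functions `Fin q → ℕ` with the indicated sum;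
`q`-element subsets of `{1,…,n}` are given by their increasing enumerations, i.e. the
strictly monotone maps `Fin q → Fin n`. -/
noncomputable def Rsum (n : ℕ) (x : Fin n → ℝ) (p : ℝ) (S : ℕ) : ℝ :=
  ∑ q ∈ Finset.Icc 1 (S / 2),
    ∑ h ∈ (Fintype.piFinset fun _ : Fin q => Finset.range (S + 1)).filter
        (fun h => (∑ r, h r) = S ∧ ∀ r, 2 ≤ h r),
      ∑ i ∈ (Finset.univ : Finset (Fin q → Fin n)).filter
          (fun i => ∀ a b : Fin q, a < b → i a < i b),
        ((S.factorial : ℝ) / ∏ r, ((h r).factorial : ℝ)) *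
          ((∏ r, |x (i r)| ^ ((p - 1) * (h r : ℝ))) *
            ∏ r, (h r : ℝ) ^ ((h r : ℝ) / 2))

/-- `Q(S₁,S₂) = Σ_{q=1}^{min(S₁,S₂)} Σ_{compositions (e) of S₁, parts ≥ 1}
Σ_{compositions (g) of S₂, parts ≥ 1} [S₁!/(e₁!⋯e_q!)]·[S₂!/(g₁!⋯g_q!)] ·
Σ_{i₁<⋯<i_q} ∏_r |x_{i_r}|^{(p−1)(e_r+g_r)} · ∏_r (e_r+g_r)^{(e_r+g_r)/2}`. -/
noncomputable def Qsum (n : ℕ) (x : Fin n → ℝ) (p : ℝ) (S₁ S₂ : ℕ) : ℝ :=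
  ∑ q ∈ Finset.Icc 1 (min S₁ S₂),
    ∑ e ∈ (Fintype.piFinset fun _ : Fin q => Finset.range (S₁ + 1)).filter
        (fun e => (∑ r, e r) = S₁ ∧ ∀ r, 1 ≤ e r),
      ∑ g ∈ (Fintype.piFinset fun _ : Fin q => Finset.range (S₂ + 1)).filter
          (fun g => (∑ r, g r) = S₂ ∧ ∀ r, 1 ≤ g r),
        ∑ i ∈ (Finset.univ : Finset (Fin q → Fin n)).filter
            (fun i => ∀ a b : Fin q, a < b → i a < i b),
          ((S₁.factorial : ℝ) / ∏ r, ((e r).factorial : ℝ)) *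
            ((S₂.factorial : ℝ) / ∏ r, ((g r).factorial : ℝ)) *
            ((∏ r, |x (i r)| ^ ((p - 1) * ((e r + g r : ℕ) : ℝ))) *
              ∏ r, ((e r + g r : ℕ) : ℝ) ^ (((e r + g r : ℕ) : ℝ) / 2))

/-- `P(S) = Σ_{q=1}^{S} Σ_{compositions (e₁,…,e_q) of 2S with parts ≥ 2}
[S!/(Γ(e₁/2+1)⋯Γ(e_q/2+1))] · Σ_{i₁<⋯<i_q} ∏_r |x_{i_r}|^{(2p−2)(e_r/2)}`. -/
noncomputable def Psum (n : ℕ) (x : Fin n → ℝ) (p : ℝ) (S : ℕ) : ℝ :=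
  ∑ q ∈ Finset.Icc 1 S,
    ∑ e ∈ (Fintype.piFinset fun _ : Fin q => Finset.range (2 * S + 1)).filter
        (fun e => (∑ r, e r) = 2 * S ∧ ∀ r, 2 ≤ e r),
      ∑ i ∈ (Finset.univ : Finset (Fin q → Fin n)).filter
          (fun i => ∀ a b : Fin q, a < b → i a < i b),
        ((S.factorial : ℝ) / ∏ r, Real.Gamma ((e r : ℝ) / 2 + 1)) *
          ∏ r, |x (i r)| ^ ((2 * p - 2) * ((e r : ℝ) / 2))

/-- **Generalized Vandermonde identity**: choosing `s` objects from the disjoint union of blocks of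
sizes `h r` amounts to choosing `e r` objects from each block, with `∑ r, e r = s`. -/
theorem sum_prod_choose_eq_choose_sum {ι : Type*} [Fintype ι] [DecidableEq ι] (h : ι → ℕ) (s : ℕ) :
    ∑ e ∈ (Fintype.piFinset fun r => Finset.range (h r + 1)).filter (fun e => ∑ r, e r = s),
      ∏ r, (h r).choose (e r) = (∑ r, h r).choose s := by
  have key : ∏ r, (1 + Polynomial.X : Polynomial ℕ) ^ h r =
      ∑ e ∈ Fintype.piFinset fun r => Finset.range (h r + 1),
        Polynomial.monomial (∑ r, e r) (∏ r, (h r).choose (e r)) := by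
    have hpow : ∀ r, (1 + Polynomial.X : Polynomial ℕ) ^ h r =
        ∑ j ∈ Finset.range (h r + 1), Polynomial.C ((h r).choose j) * Polynomial.X ^ j := by
      intro r
      rw [add_comm, add_pow]
      refine Finset.sum_congr rfl fun j _ => ?_
      simp [mul_comm]
    rw [Finset.prod_congr rfl fun r _ => hpow r, Finset.prod_univ_sum]
    refine Finset.sum_congr rfl fun e _ => ?_
    rw [Finset.prod_mul_distrib, Finset.prod_pow_eq_pow_sum, ← map_prod,
      Polynomial.C_mul_X_pow_eq_monomial]
  have hcoeff := congrArg (fun P => Polynomial.coeff P s) key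
  simp only [Finset.prod_pow_eq_pow_sum, Polynomial.coeff_one_add_X_pow,
    Polynomial.finsetSum_coeff, Polynomial.coeff_monomial] at hcoeff
  rw [Finset.sum_filter]
  simpa using hcoeff.symm

/-- The products of multinomial coefficients over all splittings `h = e + g` with `∑ e = S₁` and
`∑ g = S₂` add up to at most the multinomial coefficient of `h`. -/
theorem sum_multinomial_mul_le {ι : Type*} [Fintype ι] [DecidableEq ι] (h : ι → ℕ) (S₁ S₂ : ℕ)
    (hh : ∑ r, h r = S₁ + S₂) (T : Finset ((ι → ℕ) × (ι → ℕ)))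
    (hT : ∀ z ∈ T, z.1 + z.2 = h ∧ ∑ r, z.1 r = S₁) :
    ∑ z ∈ T, ((S₁.factorial : ℝ) / ∏ r, ((z.1 r).factorial : ℝ)) *
        ((S₂.factorial : ℝ) / ∏ r, ((z.2 r).factorial : ℝ)) ≤
      ((S₁ + S₂).factorial : ℝ) / ∏ r, ((h r).factorial : ℝ) := by
  have hpos : ∀ f : ι → ℕ, (0 : ℝ) < ∏ r, ((f r).factorial : ℝ) := fun f =>
    Finset.prod_pos fun r _ => by exact_mod_cast (f r).factorial_pos
  have hterm : ∀ z ∈ T, ((S₁.factorial : ℝ) / ∏ r, ((z.1 r).factorial : ℝ)) *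
        ((S₂.factorial : ℝ) / ∏ r, ((z.2 r).factorial : ℝ)) =
      (S₁.factorial * S₂.factorial : ℝ) / (∏ r, ((h r).factorial : ℝ)) *
        ((∏ r, (h r).choose (z.1 r) : ℕ) : ℝ) := by
    intro z hz
    have hprod : (∏ r, ((h r).factorial : ℝ)) = ((∏ r, (h r).choose (z.1 r) : ℕ) : ℝ) *
        ((∏ r, ((z.1 r).factorial : ℝ)) * ∏ r, ((z.2 r).factorial : ℝ)) := by
      push_cast
      rw [← Finset.prod_mul_distrib, ← Finset.prod_mul_distrib]
      refine Finset.prod_congr rfl fun r _ => ?_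
      rw [← (hT z hz).1, Pi.add_apply, ← Nat.add_choose_mul_factorial_mul_factorial,
        ← Nat.choose_symm_add]
      push_cast
      ring
    have h₁ := (hpos z.1).ne'
    have h₂ := (hpos z.2).ne'
    have h₃ := (hpos h).ne'
    rw [div_mul_div_comm, div_mul_eq_mul_div, div_eq_div_iff (mul_ne_zero h₁ h₂) h₃, hprod]
    ring
  have hchoose : ∑ z ∈ T, ∏ r, (h r).choose (z.1 r) ≤ (S₁ + S₂).choose S₁ := by
    have hinj : Set.InjOn Prod.fst (T : Set ((ι → ℕ) × (ι → ℕ))) := by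
      intro z hz w hw hzw
      refine Prod.ext hzw (add_left_cancel (a := z.1) ?_)
      rw [(hT z hz).1, hzw, (hT w hw).1]
    rw [← hh, ← sum_prod_choose_eq_choose_sum h S₁,
      ← Finset.sum_image (f := fun e : ι → ℕ => ∏ r, (h r).choose (e r)) hinj]
    refine Finset.sum_le_sum_of_subset fun e he => ?_
    obtain ⟨z, hz, rfl⟩ := Finset.mem_image.1 he
    obtain ⟨hzh, hzs⟩ := hT z hz
    simp only [Finset.mem_filter, Fintype.mem_piFinset, Finset.mem_range]
    refine ⟨fun r => ?_, hzs⟩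
    rw [← hzh, Pi.add_apply]
    omega
  rw [Finset.sum_congr rfl hterm, ← Finset.mul_sum, div_mul_eq_mul_div]
  refine div_le_div_of_nonneg_right ?_ (hpos h).le
  calc (S₁.factorial * S₂.factorial : ℝ) * ∑ z ∈ T, ((∏ r, (h r).choose (z.1 r) : ℕ) : ℝ)
      ≤ (S₁.factorial * S₂.factorial : ℝ) * ((S₁ + S₂).choose S₁ : ℝ) := by
        refine mul_le_mul_of_nonneg_left ?_ (by positivity)
        exact_mod_cast hchoose
    _ = ((S₁ + S₂).factorial : ℝ) := by
        rw [← Nat.add_choose_mul_factorial_mul_factorial, ← Nat.choose_symm_add]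
        push_cast
        ring

/-- `Q(S₁, S₂) ≤ R(S₁ + S₂)`. -/
theorem Qsum_le_Rsum (n : ℕ) (hn : 1 ≤ n) (x : Fin n → ℝ) (p : ℝ) (hp : 2 < p)
    (S₁ S₂ : ℕ) (hS₁ : 0 < S₁) (hS₂ : 0 < S₂) :
    Qsum n x p S₁ S₂ ≤ Rsum n x p (S₁ + S₂) := by
  unfold Qsum Rsum
  refine (Finset.sum_le_sum fun q _ => ?_).trans
    (Finset.sum_le_sum_of_subset_of_nonneg
      (Finset.Icc_subset_Icc_right (by omega : min S₁ S₂ ≤ (S₁ + S₂) / 2))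
      fun q _ _ => Finset.sum_nonneg fun h _ => Finset.sum_nonneg fun i _ => by positivity)
  rw [← Finset.sum_product', ← Finset.sum_fiberwise_of_maps_to (g := fun z => z.1 + z.2)
    (t := (Fintype.piFinset fun _ : Fin q => Finset.range (S₁ + S₂ + 1)).filter
        (fun h => (∑ r, h r) = S₁ + S₂ ∧ ∀ r, 2 ≤ h r))]
  · refine Finset.sum_le_sum fun h hh => ?_
    rw [← Finset.mul_sum]
    refine le_trans (le_of_eq (Eq.trans (Finset.sum_congr rfl fun z hz => ?_)
      (Finset.sum_mul _ _ _).symm)) (mul_le_mul_of_nonneg_right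
        (sum_multinomial_mul_le h S₁ S₂ (Finset.mem_filter.1 hh).2.1 _ fun z hz => ?_)
        (Finset.sum_nonneg fun i _ => by positivity))
    · rw [← Finset.mul_sum, ← (Finset.mem_filter.1 hz).2]
      rfl
    · obtain ⟨hz, hzh⟩ := Finset.mem_filter.1 hz
      exact ⟨hzh, (Finset.mem_filter.1 (Finset.mem_product.1 hz).1).2.1⟩
  · intro z hz
    simp only [Finset.mem_product, Finset.mem_filter, Fintype.mem_piFinset, Finset.mem_range,
      Pi.add_apply, Finset.sum_add_distrib] at hz ⊢
    obtain ⟨⟨he, hes, he'⟩, ⟨hg, hgs, hg'⟩⟩ := hz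
    refine ⟨fun r => ?_, by omega, fun r => ?_⟩
    · have := he r
      have := hg r
      omega
    · have := he' r
      have := hg' r
      omega
end

section
/- Fix an integer n ≥ 1, a vector x ∈ ℝⁿ, and a real number p > 2. Then for every positive integer S, R(S)² ≤ R(2S). -/
open Finset

/-- Multivariate Vandermonde identity. -/
theorem sum_piAntidiag_prod_choose {ι : Type*} [DecidableEq ι] (s : Finset ι) (m : ι → ℕ)
    (d : ℕ) :
    ∑ k ∈ s.piAntidiag d, ∏ i ∈ s, (m i).choose (k i) = (∑ i ∈ s, m i).choose d := by
  have h := PowerSeries.coeff_prod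
    (fun i => (((1 + Polynomial.X) ^ m i : Polynomial ℕ) : PowerSeries ℕ)) d s
  have hprod : ∏ i ∈ s, (((1 + Polynomial.X) ^ m i : Polynomial ℕ) : PowerSeries ℕ) =
      (((1 + Polynomial.X) ^ (∑ i ∈ s, m i) : Polynomial ℕ) : PowerSeries ℕ) := by
    rw [← Finset.prod_pow_eq_pow_sum]
    exact (map_prod (Polynomial.coeToPowerSeries.ringHom (R := ℕ)) _ s).symm
  simp only [hprod, Polynomial.coeff_coe, Polynomial.coeff_one_add_X_pow, Nat.cast_id] at h
  rw [h]
  symm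
  refine Finset.sum_bij (fun l _ => ⇑l) ?_ (fun _ _ _ _ h => DFunLike.coe_injective h) ?_
    (fun _ _ => rfl)
  · intro l hl
    rw [mem_finsuppAntidiag] at hl
    exact mem_piAntidiag.2 ⟨hl.1, fun i hi => hl.2 (Finsupp.mem_support_iff.2 hi)⟩
  · intro k hk
    rw [mem_piAntidiag] at hk
    exact ⟨Finsupp.onFinset s k hk.2,
      mem_finsuppAntidiag.2 ⟨hk.1, Finsupp.support_onFinset_subset⟩, rfl⟩

/-- The tuples of natural numbers with sum `S` and no entry equal to `1`. -/
def noOneTuples (n S : ℕ) : Finset (Fin n → ℕ) :=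
  ((univ : Finset (Fin n)).piAntidiag S).filter fun k => ∀ j, k j ≠ 1

theorem mem_noOneTuples {n S : ℕ} {k : Fin n → ℕ} :
    k ∈ noOneTuples n S ↔ ∑ j, k j = S ∧ ∀ j, k j ≠ 1 := by
  simp [noOneTuples]

theorem sq_factorial_mul_sum_le {n : ℕ} (f : Fin n → ℕ → ℝ) (hf : ∀ j k, 0 ≤ f j k)
    (hmul : ∀ j k l, f j k * f j l ≤ (k + l).choose k * f j (k + l)) (S : ℕ) :
    ((S.factorial : ℝ) * ∑ k ∈ noOneTuples n S, ∏ j, f j (k j)) ^ 2 ≤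
      ((2 * S).factorial : ℝ) * ∑ m ∈ noOneTuples n (2 * S), ∏ j, f j (m j) := by
  have hpairs : (∑ k ∈ noOneTuples n S, ∏ j, f j (k j)) ^ 2 ≤
      ∑ z ∈ noOneTuples n S ×ˢ noOneTuples n S,
        ∏ j, (((z.1 + z.2) j).choose (z.1 j) * f j ((z.1 + z.2) j) : ℝ) := by
    rw [sq, Finset.sum_mul_sum, ← Finset.sum_product']
    refine Finset.sum_le_sum fun z _ => ?_
    rw [← Finset.prod_mul_distrib]
    exact Finset.prod_le_prod (fun j _ => mul_nonneg (hf _ _) (hf _ _))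
      fun j _ => hmul j (z.1 j) (z.2 j)
  have hmaps : ∀ z ∈ noOneTuples n S ×ˢ noOneTuples n S,
      z.1 + z.2 ∈ noOneTuples n (2 * S) := by
    intro z hz
    rw [Finset.mem_product, mem_noOneTuples, mem_noOneTuples] at hz
    obtain ⟨⟨h1, h1'⟩, h2, h2'⟩ := hz
    refine mem_noOneTuples.2 ⟨?_, fun j => ?_⟩
    · simp only [Pi.add_apply, Finset.sum_add_distrib, h1, h2]
      ring
    · have := h1' j
      have := h2' j
      simp only [Pi.add_apply]
      omega
  have hfiber : ∀ m ∈ noOneTuples n (2 * S),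
      ∑ z ∈ noOneTuples n S ×ˢ noOneTuples n S with z.1 + z.2 = m,
        ∏ j, (((z.1 + z.2) j).choose (z.1 j) * f j ((z.1 + z.2) j) : ℝ) ≤
      ((2 * S).choose S : ℝ) * ∏ j, f j (m j) := by
    intro m hm
    have hV := sum_piAntidiag_prod_choose univ m S
    rw [(mem_noOneTuples.1 hm).1] at hV
    rw [← hV]
    push_cast
    rw [Finset.sum_mul]
    have hcongr : ∀ z ∈ (noOneTuples n S ×ˢ noOneTuples n S).filter (fun z => z.1 + z.2 = m),
        ∏ j, (((z.1 + z.2) j).choose (z.1 j) * f j ((z.1 + z.2) j) : ℝ) =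
        (∏ j, ((m j).choose (z.1 j) : ℝ)) * ∏ j, f j (m j) := by
      intro z hz
      rw [(Finset.mem_filter.1 hz).2, Finset.prod_mul_distrib]
    rw [Finset.sum_congr rfl hcongr]
    have hinj : Set.InjOn Prod.fst
        (((noOneTuples n S ×ˢ noOneTuples n S).filter (fun z => z.1 + z.2 = m) :
          Finset ((Fin n → ℕ) × (Fin n → ℕ))) : Set ((Fin n → ℕ) × (Fin n → ℕ))) := by
      intro z hz z' hz' h
      have h1 := (Finset.mem_filter.1 hz).2
      have h2 := (Finset.mem_filter.1 hz').2
      refine Prod.ext h (add_left_cancel (a := z.1) ?_)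
      rw [h1, h, h2]
    rw [← Finset.sum_image (f := fun k : Fin n → ℕ =>
      (∏ j, ((m j).choose (k j) : ℝ)) * ∏ j, f j (m j)) hinj]
    refine Finset.sum_le_sum_of_subset_of_nonneg ?_ fun k _ _ =>
      mul_nonneg (Finset.prod_nonneg fun j _ => Nat.cast_nonneg _)
        (Finset.prod_nonneg fun j _ => hf _ _)
    intro k hk
    obtain ⟨z, hz, rfl⟩ := Finset.mem_image.1 hk
    exact (Finset.mem_filter.1 (Finset.mem_product.1 (Finset.mem_filter.1 hz).1).1).1
  have hchoose : (S.factorial : ℝ) ^ 2 * ((2 * S).choose S : ℝ) = ((2 * S).factorial : ℝ) := by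
    have h := Nat.add_choose_mul_factorial_mul_factorial S S
    rw [← two_mul] at h
    rw [← h]
    push_cast
    ring
  rw [mul_pow, ← hchoose, mul_assoc]
  gcongr
  refine hpairs.trans ?_
  rw [← Finset.sum_fiberwise_of_maps_to hmaps, Finset.mul_sum]
  exact Finset.sum_le_sum hfiber

/-- The contribution of a part `h` placed at a coordinate of absolute value `y`. -/
noncomputable def partWeight (p y : ℝ) (h : ℕ) : ℝ :=
  y ^ ((p - 1) * (h : ℝ)) * (h : ℝ) ^ ((h : ℝ) / 2) / (h.factorial : ℝ)

theorem partWeight_zero (p y : ℝ) : partWeight p y 0 = 1 := by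
  simp [partWeight]

theorem partWeight_nonneg (p : ℝ) {y : ℝ} (hy : 0 ≤ y) (h : ℕ) : 0 ≤ partWeight p y h := by
  unfold partWeight
  positivity

theorem rpow_half_mul_rpow_half_le (k l : ℕ) :
    (k : ℝ) ^ ((k : ℝ) / 2) * (l : ℝ) ^ ((l : ℝ) / 2) ≤
      ((k + l : ℕ) : ℝ) ^ (((k + l : ℕ) : ℝ) / 2) := by
  have hsplit : ((k + l : ℕ) : ℝ) ^ (((k + l : ℕ) : ℝ) / 2) =
      ((k + l : ℕ) : ℝ) ^ ((k : ℝ) / 2) * ((k + l : ℕ) : ℝ) ^ ((l : ℝ) / 2) := by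
    rw [← Real.rpow_add_of_nonneg (by positivity) (by positivity) (by positivity)]
    push_cast
    ring_nf
  rw [hsplit]
  gcongr <;> omega

theorem partWeight_mul_le {p y : ℝ} (hp : 1 ≤ p) (hy : 0 ≤ y) (k l : ℕ) :
    partWeight p y k * partWeight p y l ≤ (k + l).choose k * partWeight p y (k + l) := by
  have hp' : 0 ≤ p - 1 := by linarith
  have hpow : y ^ ((p - 1) * ((k + l : ℕ) : ℝ)) =
      y ^ ((p - 1) * (k : ℝ)) * y ^ ((p - 1) * (l : ℝ)) := by
    rw [← Real.rpow_add_of_nonneg hy (by positivity) (by positivity)]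
    push_cast
    ring_nf
  have hfact : ((k + l).factorial : ℝ) = (k + l).choose k * k.factorial * l.factorial := by
    rw [← Nat.add_choose_mul_factorial_mul_factorial k l, Nat.choose_symm_add]
    push_cast
    ring
  have hc : ((k + l).choose k : ℝ) ≠ 0 := by
    exact_mod_cast (Nat.choose_pos (Nat.le_add_right k l)).ne'
  calc partWeight p y k * partWeight p y l
      = y ^ ((p - 1) * (k : ℝ)) * y ^ ((p - 1) * (l : ℝ)) *
          ((k : ℝ) ^ ((k : ℝ) / 2) * (l : ℝ) ^ ((l : ℝ) / 2)) /
          (k.factorial * l.factorial) := by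
        unfold partWeight
        field_simp
    _ ≤ y ^ ((p - 1) * (k : ℝ)) * y ^ ((p - 1) * (l : ℝ)) *
          ((k + l : ℕ) : ℝ) ^ (((k + l : ℕ) : ℝ) / 2) / (k.factorial * l.factorial) := by
        gcongr
        exact rpow_half_mul_rpow_half_le k l
    _ = (k + l).choose k * partWeight p y (k + l) := by
        unfold partWeight
        rw [hpow, hfact]
        field_simp

theorem sum_extend_zero {n q : ℕ} {i : Fin q → Fin n} (hi : Function.Injective i)
    (h : Fin q → ℕ) : ∑ j, Function.extend i h 0 j = ∑ r, h r :=
  (Fintype.sum_of_injective i hi _ _ (fun j hj => Function.extend_apply' h (0 : Fin n → ℕ) j hj)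
    fun r => (hi.extend_apply h 0 r).symm).symm

theorem extend_zero_ne_zero_iff {n q : ℕ} {i : Fin q → Fin n} (hi : Function.Injective i)
    {h : Fin q → ℕ} (hh : ∀ r, 2 ≤ h r) (j : Fin n) :
    Function.extend i h 0 j ≠ 0 ↔ j ∈ Set.range i := by
  constructor
  · intro hj
    by_contra hr
    exact hj (Function.extend_apply' _ _ _ hr)
  · rintro ⟨r, rfl⟩
    rw [hi.extend_apply]
    have := hh r
    omega

/-- `Rsum` as a sum over tuples indexed by all coordinates, zeros marking unused ones. -/
theorem Rsum_eq_sum_noOneTuples (n : ℕ) (x : Fin n → ℝ) (p : ℝ) (S : ℕ) (hS : 0 < S) :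
    Rsum n x p S =
      (S.factorial : ℝ) * ∑ k ∈ noOneTuples n S, ∏ j, partWeight p |x j| (k j) := by
  unfold Rsum
  simp_rw [← Finset.sum_product']
  rw [Finset.sum_sigma', Finset.mul_sum]
  refine Finset.sum_bij (fun t _ => Function.extend t.2.2 t.2.1 0) ?_ ?_ ?_ ?_
  · rintro ⟨q, h, i⟩ ht
    simp only [mem_sigma, mem_product, mem_filter, mem_univ, true_and] at ht
    obtain ⟨-, ⟨-, hsum, hge⟩, hmono⟩ := ht
    have hi : StrictMono i := fun a b => hmono a b
    refine mem_noOneTuples.2 ⟨(sum_extend_zero hi.injective h).trans hsum, fun j => ?_⟩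
    by_cases hj : j ∈ Set.range i
    · obtain ⟨r, rfl⟩ := hj
      simp only [hi.injective.extend_apply]
      have := hge r
      omega
    · rw [Function.extend_apply' h (0 : Fin n → ℕ) j hj]
      exact zero_ne_one
  · rintro ⟨q, h, i⟩ ht ⟨q', h', i'⟩ ht' heq
    simp only [mem_sigma, mem_product, mem_filter, mem_univ, true_and] at ht ht'
    obtain ⟨-, ⟨-, -, hge⟩, hmono⟩ := ht
    obtain ⟨-, ⟨-, -, hge'⟩, hmono'⟩ := ht'
    have hi : StrictMono i := fun a b => hmono a b
    have hi' : StrictMono i' := fun a b => hmono' a b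
    simp only at heq
    have hrange : Set.range i = Set.range i' := by
      ext j
      rw [← extend_zero_ne_zero_iff hi.injective hge, heq,
        extend_zero_ne_zero_iff hi'.injective hge']
    obtain rfl : q = q' := by
      have h1 := Set.ncard_range_of_injective hi.injective
      have h2 := Set.ncard_range_of_injective hi'.injective
      rw [hrange] at h1
      simpa using h1.symm.trans h2
    obtain rfl : i = i' := (hi.range_inj hi').1 hrange
    obtain rfl : h = h' := by
      funext r
      rw [← hi.injective.extend_apply h 0 r, heq, hi.injective.extend_apply]
    rfl
  · intro k hk
    obtain ⟨hsum, hne⟩ := mem_noOneTuples.1 hk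
    set s : Finset (Fin n) := univ.filter fun j => k j ≠ 0 with hs
    let i := s.orderEmbOfFin rfl
    have hi : StrictMono i := i.strictMono
    have hext : Function.extend i (k ∘ i) 0 = k := by
      funext j
      by_cases hj : j ∈ Set.range i
      · obtain ⟨r, rfl⟩ := hj
        rw [hi.injective.extend_apply]
        rfl
      · rw [Function.extend_apply' _ _ _ hj]
        have : j ∉ s := by
          rw [Finset.range_orderEmbOfFin] at hj
          exact_mod_cast hj
        simp only [hs, mem_filter, mem_univ, true_and, not_not] at this
        simp [this]
    have hge : ∀ r, 2 ≤ k (i r) := by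
      intro r
      have h0 : k (i r) ≠ 0 := (Finset.mem_filter.1 (s.orderEmbOfFin_mem rfl r)).2
      have := hne (i r)
      omega
    have hsum' : ∑ r, k (i r) = S := by
      rw [← hsum, ← hext, sum_extend_zero hi.injective]
      simp [hi.injective.extend_apply]
    have hcard : 2 * s.card ≤ S := by
      calc 2 * s.card = ∑ _r : Fin s.card, 2 := by simp [mul_comm]
        _ ≤ ∑ r, k (i r) := Finset.sum_le_sum fun r _ => hge r
        _ = S := hsum'
    have hpos : s.card ≠ 0 := by
      intro h0
      have : IsEmpty (Fin s.card) := by rw [h0]; infer_instance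
      rw [Fintype.sum_empty] at hsum'
      omega
    refine ⟨⟨s.card, k ∘ i, i⟩, ?_, hext⟩
    simp only [mem_sigma, mem_product, mem_filter, mem_univ, true_and, mem_Icc,
      Fintype.mem_piFinset, mem_range, Function.comp_apply]
    refine ⟨by omega, ⟨fun r => ?_, hsum', hge⟩, fun a b hab => hi hab⟩
    have := Finset.single_le_sum (f := fun r => k (i r)) (fun _ _ => Nat.zero_le _) (mem_univ r)
    omega
  · rintro ⟨q, h, i⟩ ht
    simp only [mem_sigma, mem_product, mem_filter, mem_univ, true_and] at ht
    have hi : StrictMono i := fun a b => ht.2.2 a b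
    have hprod : ∏ j, partWeight p |x j| (Function.extend i h 0 j) =
        ∏ r, partWeight p |x (i r)| (h r) := by
      refine (Fintype.prod_of_injective i hi.injective _ _ (fun j hj => ?_) fun r => ?_).symm
      · rw [Function.extend_apply' _ _ _ hj]
        exact partWeight_zero _ _
      · rw [hi.injective.extend_apply]
    rw [hprod]
    simp only [partWeight, Finset.prod_div_distrib, Finset.prod_mul_distrib]
    ring

/-- `R(S)² ≤ R(2S)`. -/
theorem Rsum_sq_le_Rsum_two_mul (n : ℕ) (hn : 1 ≤ n) (x : Fin n → ℝ) (p : ℝ)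
    (hp : 2 < p) (S : ℕ) (hS : 0 < S) :
    Rsum n x p S ^ 2 ≤ Rsum n x p (2 * S) := by
  rw [Rsum_eq_sum_noOneTuples n x p S hS, Rsum_eq_sum_noOneTuples n x p (2 * S) (by omega)]
  exact sq_factorial_mul_sum_le (fun j => partWeight p |x j|)
    (fun j => partWeight_nonneg p (abs_nonneg _))
    (fun j => partWeight_mul_le (by linarith) (abs_nonneg _)) S
end

section
/- Fix an integer n ≥ 1, a vector x ∈ ℝⁿ, and a real number p > 2. Then for every positive integer S, R(2S) ≤ (2 e S)^S · P(S), where e is Euler's number. -/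
open Finset

theorem add_two_rpow_half_le (h : ℕ) :
    ((h : ℝ) + 2) ^ ((h : ℝ) / 2) ≤ Real.exp 1 * (h : ℝ) ^ ((h : ℝ) / 2) := by
  rcases Nat.eq_zero_or_pos h with rfl | hpos
  · simp
  · have h0 : (0 : ℝ) < h := by exact_mod_cast hpos
    have key : ((h : ℝ) + 2) ≤ Real.exp (2 / h) * h := by
      have h1 := mul_le_mul_of_nonneg_right (Real.add_one_le_exp (2 / (h : ℝ))) h0.le
      have h2 : (2 / (h : ℝ) + 1) * h = h + 2 := by field_simp; ring
      linarith
    calc ((h : ℝ) + 2) ^ ((h : ℝ) / 2)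
        ≤ (Real.exp (2 / h) * h) ^ ((h : ℝ) / 2) := by gcongr
      _ = Real.exp 1 * (h : ℝ) ^ ((h : ℝ) / 2) := by
        rw [Real.mul_rpow (Real.exp_pos _).le h0.le, ← Real.exp_mul]
        congr 2
        field_simp

theorem rpow_half_mul_Gamma_le (h : ℕ) :
    (h : ℝ) ^ ((h : ℝ) / 2) * Real.Gamma ((h : ℝ) / 2 + 1)
      ≤ Real.exp ((h : ℝ) / 2) * (h.factorial : ℝ) := by
  induction h using Nat.twoStepInduction with
  | zero => simp
  | one =>
    have hpi : √Real.pi ≤ 2 := by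
      rw [Real.sqrt_le_left (by norm_num)]
      linarith [Real.pi_le_four]
    have he : (1 : ℝ) ≤ Real.exp (1 / 2) := Real.one_le_exp (by norm_num)
    rw [Nat.cast_one, Real.Gamma_add_one (by norm_num), Real.Gamma_one_half_eq]
    simp only [Real.one_rpow, Nat.factorial_one, Nat.cast_one]
    linarith
  | more h ih _ =>
    have h0 : (0 : ℝ) ≤ h := h.cast_nonneg
    have hΓ : Real.Gamma (((h + 2 : ℕ) : ℝ) / 2 + 1)
        = ((h : ℝ) / 2 + 1) * Real.Gamma ((h : ℝ) / 2 + 1) := by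
      rw [← Real.Gamma_add_one (by positivity)]
      push_cast
      ring_nf
    have hpow : (((h + 2 : ℕ) : ℝ)) ^ (((h + 2 : ℕ) : ℝ) / 2)
        = ((h : ℝ) + 2) * ((h : ℝ) + 2) ^ ((h : ℝ) / 2) := by
      push_cast
      rw [add_div, div_self two_ne_zero, Real.rpow_add_one (by positivity), mul_comm]
    have hexp : Real.exp (((h + 2 : ℕ) : ℝ) / 2) = Real.exp 1 * Real.exp ((h : ℝ) / 2) := by
      rw [← Real.exp_add]
      push_cast
      ring_nf
    have hfac : (((h + 2).factorial : ℕ) : ℝ) = ((h : ℝ) + 2) * (h + 1) * h.factorial := by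
      rw [Nat.factorial_succ, Nat.factorial_succ]
      push_cast
      ring
    have hG : 0 < Real.Gamma ((h : ℝ) / 2 + 1) := Real.Gamma_pos_of_pos (by positivity)
    rw [hΓ, hpow, hexp, hfac]
    calc ((h : ℝ) + 2) * ((h : ℝ) + 2) ^ ((h : ℝ) / 2) *
          (((h : ℝ) / 2 + 1) * Real.Gamma ((h : ℝ) / 2 + 1))
        ≤ ((h : ℝ) + 2) * (Real.exp 1 * (h : ℝ) ^ ((h : ℝ) / 2)) *
          (((h : ℝ) + 1) * Real.Gamma ((h : ℝ) / 2 + 1)) := by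
          gcongr
          · exact add_two_rpow_half_le h
          · linarith
      _ = Real.exp 1 * (((h : ℝ) + 2) * (h + 1)) *
          ((h : ℝ) ^ ((h : ℝ) / 2) * Real.Gamma ((h : ℝ) / 2 + 1)) := by ring
      _ ≤ Real.exp 1 * (((h : ℝ) + 2) * (h + 1)) *
          (Real.exp ((h : ℝ) / 2) * h.factorial) := by gcongr
      _ = _ := by ring

theorem factorial_two_mul_le (S : ℕ) :
    ((2 * S).factorial : ℝ) ≤ (2 * (S : ℝ)) ^ S * S.factorial := by
  have h : (2 * S).factorial ≤ (2 * S) ^ S * S.factorial := by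
    rw [two_mul, ← Nat.factorial_mul_ascFactorial, mul_comm]
    exact Nat.mul_le_mul_right _ (Nat.ascFactorial_le_pow_add S S)
  exact_mod_cast h

theorem multinomial_mul_prod_rpow_half_le {q S : ℕ} (h : Fin q → ℕ) (hsum : ∑ r, h r = 2 * S) :
    ((2 * S).factorial : ℝ) / (∏ r, ((h r).factorial : ℝ)) *
        ∏ r, (h r : ℝ) ^ ((h r : ℝ) / 2)
      ≤ (2 * Real.exp 1 * (S : ℝ)) ^ S *
        ((S.factorial : ℝ) / ∏ r, Real.Gamma ((h r : ℝ) / 2 + 1)) := by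
  have hΓ : ∀ r, 0 < Real.Gamma ((h r : ℝ) / 2 + 1) :=
    fun r => Real.Gamma_pos_of_pos (by positivity)
  have hprod : (∏ r, (h r : ℝ) ^ ((h r : ℝ) / 2)) * ∏ r, Real.Gamma ((h r : ℝ) / 2 + 1)
      ≤ Real.exp 1 ^ S * ∏ r, ((h r).factorial : ℝ) := by
    have hexp : ∏ r, Real.exp ((h r : ℝ) / 2) = Real.exp 1 ^ S := by
      have hcast : ∑ r, (h r : ℝ) = 2 * S := by exact_mod_cast hsum
      rw [← Real.exp_sum, ← Finset.sum_div, hcast, mul_div_cancel_left₀ _ two_ne_zero,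
        ← Real.exp_nat_mul, mul_one]
    rw [← hexp, ← Finset.prod_mul_distrib, ← Finset.prod_mul_distrib]
    exact Finset.prod_le_prod
      (fun r _ => mul_nonneg (by positivity) (hΓ r).le) fun r _ => rpow_half_mul_Gamma_le (h r)
  have hF : 0 < ∏ r, ((h r).factorial : ℝ) :=
    Finset.prod_pos fun r _ => by exact_mod_cast (h r).factorial_pos
  have hG : 0 < ∏ r, Real.Gamma ((h r : ℝ) / 2 + 1) := Finset.prod_pos fun r _ => hΓ r
  rw [div_mul_eq_mul_div, mul_div_assoc', div_le_div_iff₀ hF hG, mul_assoc]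
  calc ((2 * S).factorial : ℝ) *
        ((∏ r, (h r : ℝ) ^ ((h r : ℝ) / 2)) * ∏ r, Real.Gamma ((h r : ℝ) / 2 + 1))
      ≤ ((2 * (S : ℝ)) ^ S * S.factorial) *
        (Real.exp 1 ^ S * ∏ r, ((h r).factorial : ℝ)) :=
        mul_le_mul (factorial_two_mul_le S) hprod
          (mul_nonneg (Finset.prod_nonneg fun r _ => by positivity) hG.le) (by positivity)
    _ = _ := by rw [mul_pow, mul_pow, mul_pow]; ring

/-- `R(2S) ≤ (2eS)^S · P(S)`, with `e` Euler's number. -/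
theorem Rsum_two_mul_le_Psum (n : ℕ) (hn : 1 ≤ n) (x : Fin n → ℝ) (p : ℝ)
    (hp : 2 < p) (S : ℕ) (hS : 0 < S) :
    Rsum n x p (2 * S) ≤ (2 * Real.exp 1 * (S : ℝ)) ^ S * Psum n x p S := by
  unfold Rsum Psum
  rw [Nat.mul_div_cancel_left S two_pos]
  simp only [Finset.mul_sum]
  refine Finset.sum_le_sum fun q _ => Finset.sum_le_sum fun h hh => Finset.sum_le_sum fun i _ => ?_
  have hexponent : ∀ r, (p - 1) * (h r : ℝ) = (2 * p - 2) * ((h r : ℝ) / 2) := fun r => by ring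
  simp only [hexponent]
  have key := multinomial_mul_prod_rpow_half_le h (Finset.mem_filter.mp hh).2.1
  have hx : 0 ≤ ∏ r, |x (i r)| ^ ((2 * p - 2) * ((h r : ℝ) / 2)) :=
    Finset.prod_nonneg fun r _ => by positivity
  calc _ = _ := by rw [mul_left_comm, mul_comm]
    _ ≤ _ := mul_le_mul_of_nonneg_right key hx
    _ = _ := mul_assoc _ _ _
end

section
/- Fix an integer n ≥ 1, a vector x ∈ ℝⁿ, and a real number p > 2. Then for every positive integer S, P(S) ≤ 4^S · F_{2p−2}^S, where F_{2p−2} = Σ_{i=1}^n |x_i|^{2p−2}. -/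
open Finset

/-- The compositions of `S` into `q` positive parts. -/
def positiveCompositions (q S : ℕ) : Finset (Fin q → ℕ) :=
  (Fintype.piFinset fun _ : Fin q => Finset.range (S + 1)).filter
    (fun f => (∑ r, f r) = S ∧ ∀ r, 1 ≤ f r)

lemma mem_positiveCompositions {q S : ℕ} {f : Fin q → ℕ} :
    f ∈ positiveCompositions q S ↔ (∑ r, f r) = S ∧ ∀ r, 1 ≤ f r := by
  simp only [positiveCompositions, mem_filter, Fintype.mem_piFinset, mem_range,
    and_iff_right_iff_imp]
  rintro ⟨hf, -⟩ r
  exact Nat.lt_succ_of_le (hf ▸ single_le_sum (fun _ _ => Nat.zero_le _) (mem_univ r))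

/-- The integers `e ≥ 2` such that `e / 2` is within `1 / 2` of `k`. -/
def halfNear (k : ℕ) : Finset ℕ := (Icc (2 * k - 1) (2 * k + 1)).filter (2 ≤ ·)

lemma mem_halfNear {k e : ℕ} : e ∈ halfNear k ↔ (2 * k - 1 ≤ e ∧ e ≤ 2 * k + 1) ∧ 2 ≤ e := by
  simp [halfNear]

/-- A natural-valued function is the sum of two functions which both round its half, and whose
sums round the half of its sum. -/
lemma exists_balanced_halves {ι : Type*} [DecidableEq ι] (s : Finset ι) (e : ι → ℕ) :
    ∃ f g : ι → ℕ, (∀ i, f i + g i = e i) ∧ (∀ i, f i ≤ g i + 1) ∧ (∀ i, g i ≤ f i + 1) ∧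
      ∑ i ∈ s, f i ≤ ∑ i ∈ s, g i ∧ ∑ i ∈ s, g i ≤ ∑ i ∈ s, f i + 1 := by
  induction s using Finset.induction_on with
  | empty =>
    refine ⟨fun i => e i / 2, fun i => e i - e i / 2, ?_, ?_, ?_, ?_, ?_⟩ <;> grind
  | insert a s ha ih =>
    obtain ⟨f, g, h, hf, hg, h₁, h₂⟩ := ih
    have key (u v : ℕ) : ∑ i ∈ insert a s, Function.update f a u i = u + ∑ i ∈ s, f i ∧
        ∑ i ∈ insert a s, Function.update g a v i = v + ∑ i ∈ s, g i := by
      simp only [sum_insert ha, Function.update_self]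
      constructor <;>
      · congr 1
        exact sum_congr rfl fun i hi => Function.update_of_ne (by rintro rfl; exact ha hi) _ _
    obtain ⟨u, v, huv, hu, hv, h₃, h₄⟩ : ∃ u v : ℕ, u + v = e a ∧ u ≤ v + 1 ∧ v ≤ u + 1 ∧
        u + ∑ i ∈ s, f i ≤ v + ∑ i ∈ s, g i ∧
        v + ∑ i ∈ s, g i ≤ u + ∑ i ∈ s, f i + 1 := by
      by_cases hs : ∑ i ∈ s, f i = ∑ i ∈ s, g i
      · exact ⟨e a / 2, e a - e a / 2, by omega, by omega, by omega, by omega, by omega⟩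
      · exact ⟨e a - e a / 2, e a / 2, by omega, by omega, by omega, by omega, by omega⟩
    refine ⟨Function.update f a u, Function.update g a v, ?_, ?_, ?_, ?_, ?_⟩
    · intro i; by_cases hi : i = a
      · subst hi; simpa using huv
      · simpa [hi] using h i
    · intro i; by_cases hi : i = a
      · subst hi; simpa using hu
      · simpa [hi] using hf i
    · intro i; by_cases hi : i = a
      · subst hi; simpa using hv
      · simpa [hi] using hg i
    · rw [(key u v).1, (key u v).2]; exact h₃
    · rw [(key u v).1, (key u v).2]; exact h₄

/-- A monomial with half-integer exponents `e / 2 ≥ 1` of integral total degree is bounded by the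
sum of the monomials of the same degree whose exponents round `e / 2`. -/
lemma prod_rpow_half_le_sum {q S : ℕ} (y : Fin q → ℝ) (hy : ∀ r, 0 ≤ y r) (e : Fin q → ℕ)
    (he : ∑ r, e r = 2 * S) (he2 : ∀ r, 2 ≤ e r) :
    ∏ r, y r ^ ((e r : ℝ) / 2) ≤
      ∑ f ∈ (positiveCompositions q S).filter (fun f => ∀ r, e r ∈ halfNear (f r)),
        ∏ r, y r ^ f r := by
  obtain ⟨f, g, h, hf, hg, h₁, h₂⟩ := exists_balanced_halves univ e
  have hsum : ∑ r, f r + ∑ r, g r = 2 * S := by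
    rw [← he, ← sum_add_distrib]; exact sum_congr rfl fun r _ => h r
  have mem (k : Fin q → ℕ) (hk : ∑ r, k r = S) (hk' : ∀ r, k r = f r ∨ k r = g r) :
      k ∈ (positiveCompositions q S).filter (fun k => ∀ r, e r ∈ halfNear (k r)) := by
    simp only [mem_filter, mem_positiveCompositions, mem_halfNear]
    refine ⟨⟨hk, fun r => ?_⟩, fun r => ?_⟩ <;>
    · have := hk' r; have := h r; have := hf r; have := hg r; have := he2 r
      omega
  have hfm := mem f (by omega) (fun _ => .inl rfl)
  have hgm := mem g (by omega) (fun _ => .inr rfl)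
  have nonneg (k : Fin q → ℕ) : 0 ≤ ∏ r, y r ^ k r := prod_nonneg fun r _ => pow_nonneg (hy r) _
  have hle {k : Fin q → ℕ}
      (hk : k ∈ (positiveCompositions q S).filter (fun k => ∀ r, e r ∈ halfNear (k r))) :=
    single_le_sum (f := fun k : Fin q → ℕ => ∏ r, y r ^ k r) (fun k _ => nonneg k) hk
  have hsq : (∏ r, y r ^ ((e r : ℝ) / 2)) ^ 2 = (∏ r, y r ^ f r) * ∏ r, y r ^ g r := by
    rw [← prod_pow, ← prod_mul_distrib]
    refine prod_congr rfl fun r _ => ?_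
    rw [← pow_add, h r, ← Real.rpow_natCast, ← Real.rpow_mul (hy r), ← Real.rpow_natCast]
    congr 1
    push_cast
    ring
  refine le_of_sq_le_sq ?_ ((nonneg f).trans (hle hfm))
  rw [hsq, sq]
  exact mul_le_mul (hle hfm) (hle hgm) (nonneg g) ((nonneg f).trans (hle hfm))

lemma factorial_le_Gamma_of_le {m : ℕ} (hm : 1 ≤ m) {t : ℝ} (ht : (m : ℝ) + 1 ≤ t) :
    (m.factorial : ℝ) ≤ Real.Gamma t := by
  have hm' : (1 : ℝ) ≤ m := by exact_mod_cast hm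
  rw [← Real.Gamma_nat_eq_factorial]
  exact Real.Gamma_strictMonoOn_Ici.monotoneOn (Set.mem_Ici.2 (by linarith))
    (Set.mem_Ici.2 (by linarith)) ht

lemma Gamma_half_add_one_pos (e : ℕ) : 0 < Real.Gamma ((e : ℝ) / 2 + 1) :=
  Real.Gamma_pos_of_pos (by positivity)

lemma sum_halfNear_inv_Gamma_le {k : ℕ} (hk : 1 ≤ k) :
    ∑ e ∈ halfNear k, (Real.Gamma ((e : ℝ) / 2 + 1))⁻¹ ≤ 4 ^ k / (k.factorial : ℝ) := by
  have hfac : (0 : ℝ) < k.factorial := by positivity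
  have hbig {e : ℕ} (he : 2 * k ≤ e) :
      (Real.Gamma ((e : ℝ) / 2 + 1))⁻¹ ≤ 1 / (k.factorial : ℝ) := by
    rw [one_div]
    refine inv_anti₀ hfac (factorial_le_Gamma_of_le hk ?_)
    have : (2 * k : ℝ) ≤ e := by exact_mod_cast he
    linarith
  obtain rfl | hk2 := hk.eq_or_lt
  · have : halfNear 1 = {2, 3} := by decide
    rw [this, sum_pair (by norm_num)]
    have h₂ := hbig (e := 2) le_rfl
    have h₃ := hbig (e := 3) (by norm_num)
    norm_num at h₂ h₃ ⊢
    linarith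
  · obtain ⟨m, rfl⟩ : ∃ m, k = m + 1 := ⟨k - 1, by omega⟩
    have hset : halfNear (m + 1) = {2 * m + 1, 2 * m + 2, 2 * m + 3} := by
      ext e
      simp only [mem_halfNear, mem_insert, mem_singleton]
      omega
    have h₁ : (Real.Gamma (((2 * m + 1 : ℕ) : ℝ) / 2 + 1))⁻¹ ≤
        ((m + 1 : ℕ) : ℝ) / ((m + 1).factorial : ℝ) := by
      have : ((m + 1 : ℕ) : ℝ) / ((m + 1).factorial : ℝ) = (m.factorial : ℝ)⁻¹ := by
        rw [Nat.factorial_succ]; push_cast; field_simp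
      rw [this]
      refine inv_anti₀ (by positivity) (factorial_le_Gamma_of_le (by omega) ?_)
      push_cast
      linarith
    have h₂ := hbig (e := 2 * m + 2) (by omega)
    have h₃ := hbig (e := 2 * m + 3) (by omega)
    rw [hset, sum_insert (by simp), sum_pair (by simp)]
    have hpow : ((m + 1 : ℕ) : ℝ) + 2 ≤ 4 ^ (m + 1) := by
      have := one_add_mul_le_pow (a := (3 : ℝ)) (by norm_num) (m + 1)
      norm_num at this ⊢
      linarith [m.cast_nonneg (α := ℝ)]
    calc _ ≤ ((m + 1 : ℕ) : ℝ) / ((m + 1).factorial : ℝ) +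
          (1 / ((m + 1).factorial : ℝ) + 1 / ((m + 1).factorial : ℝ)) := by gcongr
      _ = (((m + 1 : ℕ) : ℝ) + 2) / ((m + 1).factorial : ℝ) := by ring
      _ ≤ _ := by gcongr

/-- Rounding the exponents of the half-integer compositions costs at most a factor `4 ^ S`. -/
lemma sum_half_compositions_le {q S : ℕ} (y : Fin q → ℝ) (hy : ∀ r, 0 ≤ y r) :
    ∑ e ∈ (Fintype.piFinset fun _ : Fin q => Finset.range (2 * S + 1)).filter
        (fun e => (∑ r, e r) = 2 * S ∧ ∀ r, 2 ≤ e r),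
      (∏ r, Real.Gamma ((e r : ℝ) / 2 + 1))⁻¹ * ∏ r, y r ^ ((e r : ℝ) / 2) ≤
    4 ^ S * ∑ f ∈ positiveCompositions q S,
      (∏ r, ((f r).factorial : ℝ))⁻¹ * ∏ r, y r ^ f r := by
  set E := (Fintype.piFinset fun _ : Fin q => Finset.range (2 * S + 1)).filter
        (fun e => (∑ r, e r) = 2 * S ∧ ∀ r, 2 ≤ e r) with hE
  have hG (e : Fin q → ℕ) : 0 ≤ (∏ r, Real.Gamma ((e r : ℝ) / 2 + 1))⁻¹ :=
    inv_nonneg.2 (prod_nonneg fun r _ => (Gamma_half_add_one_pos _).le)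
  calc _ ≤ ∑ e ∈ E, (∏ r, Real.Gamma ((e r : ℝ) / 2 + 1))⁻¹ *
        ∑ f ∈ (positiveCompositions q S).filter (fun f => ∀ r, e r ∈ halfNear (f r)),
          ∏ r, y r ^ f r := by
        refine sum_le_sum fun e he => mul_le_mul_of_nonneg_left ?_ (hG e)
        have := (mem_filter.1 he).2
        exact prod_rpow_half_le_sum y hy e this.1 this.2
    _ = ∑ f ∈ positiveCompositions q S, (∑ e ∈ E.filter (fun e => ∀ r, e r ∈ halfNear (f r)),
        (∏ r, Real.Gamma ((e r : ℝ) / 2 + 1))⁻¹) * ∏ r, y r ^ f r := by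
        simp only [mul_sum, sum_mul]
        refine sum_comm' fun e f => ?_
        simp only [mem_filter]
        tauto
    _ ≤ ∑ f ∈ positiveCompositions q S, (4 ^ S * (∏ r, ((f r).factorial : ℝ))⁻¹) *
        ∏ r, y r ^ f r := by
        refine sum_le_sum fun f hf => mul_le_mul_of_nonneg_right ?_
          (prod_nonneg fun r _ => pow_nonneg (hy r) _)
        rw [mem_positiveCompositions] at hf
        calc _ ≤ ∑ e ∈ Fintype.piFinset fun r => halfNear (f r),
              (∏ r, Real.Gamma ((e r : ℝ) / 2 + 1))⁻¹ := by
              refine sum_le_sum_of_subset_of_nonneg (fun e he => ?_) fun e _ _ => hG e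
              exact Fintype.mem_piFinset.2 (mem_filter.1 he).2
          _ = ∏ r, ∑ e ∈ halfNear (f r), (Real.Gamma ((e : ℝ) / 2 + 1))⁻¹ := by
              simp only [prod_univ_sum, prod_inv_distrib]
          _ ≤ ∏ r, (4 ^ f r / ((f r).factorial : ℝ)) :=
              prod_le_prod
                (fun r _ => sum_nonneg fun e _ => inv_nonneg.2 (Gamma_half_add_one_pos e).le)
                fun r _ => sum_halfNear_inv_Gamma_le (hf.2 r)
          _ = _ := by
              rw [prod_div_distrib, prod_pow_eq_pow_sum, hf.1, div_eq_mul_inv]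
    _ = _ := by simp only [mul_sum, mul_assoc]

lemma support_extend_zero {q n : ℕ} {i : Fin q → Fin n} (hi : StrictMono i) {f : Fin q → ℕ}
    (hf : ∀ r, 1 ≤ f r) : Function.support (Function.extend i f 0) = Set.range i := by
  ext j
  by_cases hj : ∃ r, i r = j
  · obtain ⟨r, rfl⟩ := hj
    simpa [hi.injective.extend_apply] using Nat.one_le_iff_ne_zero.1 (hf r)
  · simpa [Function.extend_apply' _ _ _ hj] using hj

/-- The multinomial theorem, with monomials grouped by their supports. -/
lemma sum_strictMono_compositions_le_pow {n : ℕ} (y : Fin n → ℝ) (hy : ∀ j, 0 ≤ y j) (S : ℕ) :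
    ∑ q ∈ Finset.Icc 1 S,
      ∑ i ∈ (Finset.univ : Finset (Fin q → Fin n)).filter
          (fun i => ∀ a b : Fin q, a < b → i a < i b),
        ∑ f ∈ positiveCompositions q S, (S.factorial : ℝ) *
          ((∏ r, ((f r).factorial : ℝ))⁻¹ * ∏ r, y (i r) ^ f r) ≤
    (∑ j, y j) ^ S := by
  set w : (Fin n → ℕ) → ℝ := fun g => (S.factorial : ℝ) *
    ((∏ j, ((g j).factorial : ℝ))⁻¹ * ∏ j, y j ^ g j) with hw
  have hw0 (g) : 0 ≤ w g := by
    have := prod_nonneg fun j (_ : j ∈ univ) => pow_nonneg (hy j) (g j)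
    positivity
  have hpow : (∑ j, y j) ^ S = ∑ g ∈ piAntidiag univ S, w g := by
    rw [sum_pow_eq_sum_piAntidiag]
    refine sum_congr rfl fun g hg => ?_
    have hs := Nat.multinomial_spec univ g
    rw [(mem_piAntidiag.1 hg).1] at hs
    have hne : (∏ j, ((g j).factorial : ℝ)) ≠ 0 := prod_ne_zero_iff.2 fun j _ => by positivity
    have hs' : (∏ j, ((g j).factorial : ℝ)) * Nat.multinomial univ g = S.factorial := by
      exact_mod_cast hs
    rw [hw]
    simp only
    rw [← hs', ← mul_assoc, mul_right_comm _ _ (∏ j, ((g j).factorial : ℝ))⁻¹,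
      mul_inv_cancel₀ hne, one_mul]
  set T : Finset (Σ q : ℕ, (Fin q → Fin n) × (Fin q → ℕ)) := (Finset.Icc 1 S).sigma fun q =>
    ((Finset.univ : Finset (Fin q → Fin n)).filter (fun i => ∀ a b : Fin q, a < b → i a < i b)) ×ˢ
      positiveCompositions q S with hT
  have hTmem {t} (ht : t ∈ T) : StrictMono t.2.1 ∧ ∑ r, t.2.2 r = S ∧ ∀ r, 1 ≤ t.2.2 r := by
    simp only [hT, mem_sigma, mem_product, mem_filter, mem_univ, true_and,
      mem_positiveCompositions] at ht
    exact ⟨fun a b => ht.2.1 a b, ht.2.2⟩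
  set φ : (Σ q : ℕ, (Fin q → Fin n) × (Fin q → ℕ)) → Fin n → ℕ :=
    fun t => Function.extend t.2.1 t.2.2 0 with hφ
  have hinj : Set.InjOn φ T := by
    rintro ⟨q, i, f⟩ ht ⟨q', i', f'⟩ ht' h
    obtain ⟨hi, -, hf⟩ := hTmem ht
    obtain ⟨hi', -, hf'⟩ := hTmem ht'
    simp only [hφ] at h hi hf hi' hf'
    have hrange : Set.range i = Set.range i' := by
      rw [← support_extend_zero hi hf, h, support_extend_zero hi' hf']
    obtain rfl : q = q' := by
      simpa [Set.ncard_range_of_injective hi.injective,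
        Set.ncard_range_of_injective hi'.injective] using congrArg Set.ncard hrange
    obtain rfl := (hi.range_inj hi').1 hrange
    obtain rfl : f = f' := by
      funext r
      simpa [hi.injective.extend_apply] using congrFun h (i r)
    rfl
  have hmaps {t} (ht : t ∈ T) : φ t ∈ piAntidiag univ S := by
    obtain ⟨hi, hs, -⟩ := hTmem ht
    refine mem_piAntidiag.2 ⟨?_, fun _ _ => mem_univ _⟩
    rw [← hs]
    refine (Fintype.sum_of_injective t.2.1 hi.injective _ _ (fun j hj => ?_) fun r => ?_).symm
    · exact Function.extend_apply' _ _ _ hj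
    · exact (hi.injective.extend_apply _ _ _).symm
  have hval {t} (ht : t ∈ T) : w (φ t) = (S.factorial : ℝ) *
      ((∏ r, ((t.2.2 r).factorial : ℝ))⁻¹ * ∏ r, y (t.2.1 r) ^ t.2.2 r) := by
    obtain ⟨hi, -, -⟩ := hTmem ht
    simp only [hw, hφ]
    rw [← Fintype.prod_of_injective t.2.1 hi.injective (fun r => ((t.2.2 r).factorial : ℝ)) _
        (fun j hj => by simp [Function.extend_apply' _ _ _ hj])
        fun r => by rw [hi.injective.extend_apply],
      ← Fintype.prod_of_injective t.2.1 hi.injective (fun r => y (t.2.1 r) ^ t.2.2 r) _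
        (fun j hj => by simp [Function.extend_apply' _ _ _ hj])
        fun r => by rw [hi.injective.extend_apply]]
  calc _ = ∑ t ∈ T, (S.factorial : ℝ) *
        ((∏ r, ((t.2.2 r).factorial : ℝ))⁻¹ * ∏ r, y (t.2.1 r) ^ t.2.2 r) := by
        simp only [hT, sum_sigma, sum_product]
    _ = ∑ g ∈ T.image φ, w g := by
        rw [sum_image hinj]
        exact sum_congr rfl fun t ht => (hval ht).symm
    _ ≤ _ := by
        rw [hpow]
        exact sum_le_sum_of_subset_of_nonneg (image_subset_iff.2 fun t ht => hmaps ht)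
          fun g _ _ => hw0 g

/-- `P(S) ≤ 4^S · F_{2p−2}^S`, where `F_{2p−2} = Σ_i |x_i|^{2p−2}`. -/
theorem Psum_le_moment_pow (n : ℕ) (hn : 1 ≤ n) (x : Fin n → ℝ) (p : ℝ)
    (hp : 2 < p) (S : ℕ) (hS : 0 < S) :
    Psum n x p S ≤ 4 ^ S * (∑ i, |x i| ^ (2 * p - 2)) ^ S := by
  have hy (j : Fin n) : 0 ≤ |x j| ^ (2 * p - 2) := Real.rpow_nonneg (abs_nonneg _) _
  refine le_trans ?_ (mul_le_mul_of_nonneg_left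
    (sum_strictMono_compositions_le_pow (fun j => |x j| ^ (2 * p - 2)) hy S) (by positivity))
  rw [Psum, mul_sum]
  refine sum_le_sum fun q _ => ?_
  rw [sum_comm, mul_sum]
  refine sum_le_sum fun i _ => ?_
  have h := mul_le_mul_of_nonneg_left
    (sum_half_compositions_le (S := S) (fun r => |x (i r)| ^ (2 * p - 2)) fun r => hy (i r))
    (S.factorial.cast_nonneg (α := ℝ))
  simp only [← Real.rpow_mul (abs_nonneg _)] at h
  rw [mul_left_comm, mul_sum, mul_sum] at h
  simpa only [div_eq_mul_inv, mul_assoc] using h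
end
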